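/- arXiv:1210.1539 — 2 statements merged into one kernel-verified Lean document; each statement's English description precedes it below -/
import Mathlib

section
/- (Vassiliev's conjecture / Manturov's theorem.) A 4-regular X-graph admits an X-embedding into the plane if and only if it does not contain two cycles without common edges having exactly one crossing vertex, where a crossing vertex is a common vertex passed by each of the two cycles through a pair of opposite half-edges. -/
/-!
We model a finite multigraph combinatorially by its half-edges ("darts"):
`edgeInv` is a fixed-point-free involution pairing the two darts of each edge,
and the vertices are the cycles of the permutation `rot`; the cycle of `rot`
through a dart is a chosen orientation of the unoriented cyclic order
(the *-structure) at that vertex.  All notions defined below are invariant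
under reversing the chosen orientation at a vertex, so such a structure
faithfully represents a *-graph.  An embedding of the graph into the sphere
(equivalently, the plane) is modelled, as usual in topological graph theory,
by a rotation system whose Euler characteristic is `2` on every connected
component; it is a *-embedding when the rotation at each vertex agrees with
the *-structure or with its reversal.
-/

/-- A *-graph, encoded by half-edges (darts). -/
structure StarGraph where
  /-- the type of darts (half-edges) -/
  D : Type
  [fintypeD : Fintype D]
  [decEqD : DecidableEq D]
  /-- the fixed-point-free involution matching the two darts of each edge -/
  edgeInv : Equiv.Perm D
  /-- a permutation whose cycles are the vertices; its cycle through a dart is a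
  chosen orientation of the unoriented cyclic order (*-structure) at that vertex -/
  rot : Equiv.Perm D
  edgeInv_invol : ∀ d, edgeInv (edgeInv d) = d
  edgeInv_ne : ∀ d, edgeInv d ≠ d

attribute [instance] StarGraph.fintypeD StarGraph.decEqD

namespace StarGraph

variable (G : StarGraph)

/-- Two darts emanate from the same vertex iff they lie on the same cycle of `rot`. -/
def SameVertex (d e : G.D) : Prop := G.rot.SameCycle d e

/-- The degree of the vertex from which the dart `d` emanates. -/
noncomputable def degree (d : G.D) : ℕ := Nat.card {e : G.D // G.SameVertex d e}

/-- The number of cycles (orbits, including fixed points) of a permutation. -/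
noncomputable def cycleCount {α : Type*} (f : Equiv.Perm α) : ℕ :=
  Nat.card (Quotient (Equiv.Perm.SameCycle.setoid f))

/-- The number of vertices. -/
noncomputable def numVertices : ℕ := cycleCount G.rot

/-- The number of edges. -/
noncomputable def numEdges : ℕ := Fintype.card G.D / 2

/-- The number of connected components. -/
noncomputable def numComponents : ℕ :=
  Nat.card (Quotient (Relation.EqvGen.setoid (fun d e : G.D => e = G.rot d ∨ e = G.edgeInv d)))

/-- The number of faces of the embedding determined by the rotation system `ρ`:
the number of cycles of the face permutation `ρ * edgeInv`. -/
noncomputable def numFaces (ρ : Equiv.Perm G.D) : ℕ := cycleCount (ρ * G.edgeInv)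

/-- `ρ` is a rotation system compatible with the *-structure:  at each vertex it
agrees with the chosen orientation of the cyclic order or with its reversal. -/
def IsCompatibleRotation (ρ : Equiv.Perm G.D) : Prop :=
  ∀ d : G.D, (∀ e, G.SameVertex d e → ρ e = G.rot e) ∨
             (∀ e, G.SameVertex d e → ρ e = G.rot⁻¹ e)

/-- `ρ` is a rotation system describing a *-embedding of `G` into the sphere
(equivalently, the plane): it is compatible with the *-structure and has Euler
characteristic `2` on each connected component. -/
def IsPlanarStarEmbedding (ρ : Equiv.Perm G.D) : Prop :=
  G.IsCompatibleRotation ρ ∧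
    (G.numVertices : ℤ) - G.numEdges + G.numFaces ρ = 2 * G.numComponents

/-- `G` admits a *-embedding into the plane. -/
def StarPlanar : Prop := ∃ ρ : Equiv.Perm G.D, G.IsPlanarStarEmbedding ρ

end StarGraph

/-- A cycle in the sense of Vassiliev's planarity criterion: a closed walk,
recorded by the cyclically ordered sequence of darts it traverses, that repeats
no edge (repeated vertices are allowed). -/
structure ClosedTrail (G : StarGraph) where
  /-- the number of edges of the cycle -/
  len : ℕ
  len_pos : 0 < len
  /-- the dart along which the walk leaves its `i`-th vertex -/
  dart : ZMod len → G.D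
  /-- the walk is closed: the head of each traversed edge is the tail of the next -/
  next_sameVertex : ∀ i, G.SameVertex (G.edgeInv (dart i)) (dart (i + 1))
  /-- no edge is repeated -/
  edges_injective : ∀ i j, (dart i = dart j ∨ dart i = G.edgeInv (dart j)) → i = j

/-- Two closed trails have no common edge. -/
def ClosedTrail.EdgeDisjoint {G : StarGraph} (A B : ClosedTrail G) : Prop :=
  ∀ i j, A.dart i ≠ B.dart j ∧ A.dart i ≠ G.edgeInv (B.dart j)

/-- The least positive number of steps needed to get from `x` to `y` along the
permutation `σ` (junk value `0` if `y` is not on the cycle of `x`). -/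
noncomputable def stepsTo {α : Type*} (σ : Equiv.Perm α) (x y : α) : ℕ :=
  sInf {m : ℕ | 0 < m ∧ (σ ^ m) x = y}

/-- The four darts `a₁, a₂, b₁, b₂`, lying on one cycle of `σ`, appear in this
cycle in alternating order: starting at `a₁`, one of `b₁, b₂` is met strictly
before `a₂` and the other strictly after.  This is invariant under replacing
`σ` by `σ⁻¹`, i.e. it only depends on the unoriented cyclic order. -/
def Alternating {α : Type*} (σ : Equiv.Perm α) (a₁ a₂ b₁ b₂ : α) : Prop :=
  (stepsTo σ a₁ b₁ < stepsTo σ a₁ a₂ ∧ stepsTo σ a₁ a₂ < stepsTo σ a₁ b₂) ∨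
  (stepsTo σ a₁ b₂ < stepsTo σ a₁ a₂ ∧ stepsTo σ a₁ a₂ < stepsTo σ a₁ b₁)

/-- The pair of passes `(i, j)` is a crossing of the closed trails `A` and `B`:
at its `i`-th step `A` passes through a vertex `v` along the half-edges
`A₁ = edgeInv (A.dart (i-1))` (incoming) and `A₂ = A.dart i` (outgoing), `B`
passes through the same vertex `v` at its `j`-th step along `B₁, B₂`, and
`A₁, B₁, A₂, B₂` alternate in the cyclic order at `v`.  Counting crossings
means counting such pairs `(i, j)`, i.e. crossings are counted with
multiplicity. -/
def ClosedTrail.IsCrossing {G : StarGraph} (A B : ClosedTrail G)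
    (p : ZMod A.len × ZMod B.len) : Prop :=
  G.SameVertex (A.dart p.1) (B.dart p.2) ∧
  Alternating G.rot (G.edgeInv (A.dart (p.1 - 1))) (A.dart p.1)
    (G.edgeInv (B.dart (p.2 - 1))) (B.dart p.2)

/-- A Vassiliev obstruct: a pair of edge-disjoint cycles having exactly one
crossing (with multiplicity). -/
def HasVassilievObstruct (G : StarGraph) : Prop :=
  ∃ A B : ClosedTrail G, A.EdgeDisjoint B ∧
    Nat.card {p : ZMod A.len × ZMod B.len // A.IsCrossing B p} = 1

/-!
An X-graph is a 4-regular multigraph with a partition of the four half-edges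
at each vertex into two pairs of opposite half-edges.  On 4-valent vertices
this X-structure is equivalent to a *-structure: the opposite half-edge of a
dart `d` is `rot² d`, the dart at distance two in the cyclic order.  Hence we
model X-graphs as 4-regular `StarGraph`s; an X-embedding is then exactly a
compatible planar rotation system as in `StarGraph.StarPlanar`, since at a
4-valent vertex a cyclic order (up to reversal) alternating between the two
opposite pairs is the same data as the pairing itself.
-/

/-- The pair of passes `(i, j)` is a crossing vertex for the closed trails `A`
and `B`: at its `i`-th step `A` passes through a vertex `v` along a pair of
opposite half-edges, `B` passes through the same vertex `v` at its `j`-th step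
along a pair of opposite half-edges.  Counting crossing vertices means counting
such pairs `(i, j)`, i.e. they are counted with multiplicity. -/
def ClosedTrail.IsCrossingVertex {G : StarGraph} (A B : ClosedTrail G)
    (p : ZMod A.len × ZMod B.len) : Prop :=
  G.SameVertex (A.dart p.1) (B.dart p.2) ∧
  (G.rot ^ 2) (G.edgeInv (A.dart (p.1 - 1))) = A.dart p.1 ∧
  (G.rot ^ 2) (G.edgeInv (B.dart (p.2 - 1))) = B.dart p.2



namespace XG

/-- Abstract 4-regular X-graph data: edge involution `e`, rotation `r`, vertex map `q`. -/
structure XD {D V : Type} (e r : D → D) (q : D → V) : Prop where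
  ee : ∀ d, e (e d) = d
  ene : ∀ d, e d ≠ d
  r4 : ∀ d, r (r (r (r d))) = d
  r1 : ∀ d, r d ≠ d
  r2 : ∀ d, r (r d) ≠ d
  qiff : ∀ x y, q x = q y ↔ (y = x ∨ y = r x ∨ y = r (r x) ∨ y = r (r (r x)))
  qsurj : Function.Surjective q

/-- Cycle space over `ZMod 2`. -/
def InZ {D : Type} (e r : D → D) (ψ : D → ZMod 2) : Prop :=
  (∀ d, ψ (e d) = ψ d) ∧ ∀ d, ψ d + ψ (r d) + ψ (r (r d)) + ψ (r (r (r d))) = 0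

/-- Crossing pattern at a dart. -/
def Pat {D : Type} (r : D → D) (α β : D → ZMod 2) (d : D) : Prop :=
  α d = 1 ∧ α (r (r d)) = 1 ∧ β (r d) = 1 ∧ β (r (r (r d))) = 1

/-- Algebraic obstruction: disjoint cycle-space elements with exactly one crossing vertex. -/
def Obs {D V : Type} (e r : D → D) (q : D → V) : Prop :=
  ∃ α β : D → ZMod 2, InZ e r α ∧ InZ e r β ∧ (∀ d, ¬ (α d = 1 ∧ β d = 1)) ∧
    ∃ d, Pat r α β d ∧ ∀ d', Pat r α β d' → q d' = q d

/-- A turning (non-straight) transition system. -/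
structure Turn {D : Type} (r : D → D) (τ : D → D) : Prop where
  tr : ∀ x, τ x = r x ∨ τ x = r (r (r x))
  tt : ∀ x, τ (τ x) = x

theorem z2_cases (a : ZMod 2) : a = 0 ∨ a = 1 := by revert a; decide
theorem z2_self (a : ZMod 2) : a + a = 0 := by revert a; decide
theorem z2_eq {a b : ZMod 2} (h : a + b = 0) : a = b := by revert a b; decide

section
variable {D V : Type} {e r : D → D} {q : D → V}

theorem XD.r3 (X : XD e r q) (d : D) : r (r (r d)) ≠ d := by
  intro h
  have := X.r4 d
  rw [h] at this
  exact X.r1 d this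

theorem XD.qr (X : XD e r q) (d : D) : q (r d) = q d := ((X.qiff _ _).2 (by simp)).symm
theorem XD.qrr (X : XD e r q) (d : D) : q (r (r d)) = q d := by rw [X.qr, X.qr]

theorem XD.rinj (X : XD e r q) {a b : D} (h : r a = r b) : a = b := by
  rw [← X.r4 a, h, X.r4]

theorem Turn.qt (X : XD e r q) {τ : D → D} (T : Turn r τ) (d : D) : q (τ d) = q d := by
  rcases T.tr d with h | h <;> rw [h] <;> simp [X.qr]

theorem Turn.tne (X : XD e r q) {τ : D → D} (T : Turn r τ) (d : D) : τ d ≠ d := by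
  rcases T.tr d with h | h <;> rw [h]
  · exact X.r1 d
  · exact X.r3 d

/-- `τ` commutes with passing to the opposite dart. -/
theorem Turn.trr (X : XD e r q) {τ : D → D} (T : Turn r τ) (d : D) :
    τ (r (r d)) = r (r (τ d)) := by
  rcases T.tr d with h | h
  · rcases T.tr (r (r d)) with h' | h'
    · rw [h', h]
    · rw [X.r4] at h'
      have := T.tt d
      rw [h, ← h', T.tt] at this
      exact absurd this (X.r2 d)
  · rcases T.tr (r (r d)) with h' | h'
    · have := T.tt d
      rw [h, ← h', T.tt] at this
      exact absurd this (X.r2 d)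
    · rw [h', h]

theorem Turn.sum4 (X : XD e r q) {A : Type} [AddCommMonoid A] {τ : D → D} (T : Turn r τ)
    (h : D → A) (d : D) :
    h d + h (r d) + h (r (r d)) + h (r (r (r d))) = h d + h (τ d) + h (r (r d)) + h (r (r (τ d))) := by
  rcases T.tr d with h' | h' <;> rw [h']
  rw [X.r4 (r d)]
  abel

theorem Turn.q4 (X : XD e r q) {τ : D → D} (T : Turn r τ) {x y : D} (h : q y = q x) :
    y = x ∨ y = τ x ∨ y = r (r x) ∨ y = r (r (τ x)) := by
  have := (X.qiff x y).1 h.symm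
  rcases T.tr x with h' | h' <;> rw [h']
  · tauto
  · rw [X.r4 (r x)]; tauto

/-- sums of functions anti-invariant under an involution -/
theorem sum_inv2 [Fintype D] {ι : D → D} (h1 : ∀ d, ι (ι d) = d) (h2 : ∀ d, ι d ≠ d)
    (h : D → ZMod 2) (hh : ∀ d, h (ι d) = h d) : ∑ d, h d = 0 := by
  apply Finset.sum_involution (fun d _ => ι d)
  · intro d _; rw [hh]; exact z2_self _
  · intro d _ _; exact h2 d
  · intro d _; exact Finset.mem_univ _
  · intro d _; exact h1 d

theorem sum_invZ [Fintype D] {ι : D → D} (h1 : ∀ d, ι (ι d) = d)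
    (h : D → ℤ) (hh : ∀ d, h (ι d) = - h d) : ∑ d, h d = 0 := by
  have : ∑ d, h d = ∑ d, h (ι d) := by
    refine (Fintype.sum_equiv (⟨ι, ι, h1, h1⟩ : D ≃ D) _ _ (fun _ => rfl)).symm
  simp only [hh, Finset.sum_neg_distrib] at this
  omega

theorem sum_fiber [Fintype D] [DecidableEq V] (X : XD e r q) {A : Type} [AddCommMonoid A]
    (h : D → A) (x : D) : (∑ d, if q d = q x then h d else 0) =
      h x + h (r x) + h (r (r x)) + h (r (r (r x))) := by
  classical
  rw [← Finset.sum_filter]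
  have : (Finset.univ.filter fun d => q d = q x) = {x, r x, r (r x), r (r (r x))} := by
    ext y
    simp only [Finset.mem_filter, Finset.mem_univ, true_and, Finset.mem_insert,
      Finset.mem_singleton]
    rw [eq_comm, X.qiff]
  rw [this, Finset.sum_insert, Finset.sum_insert, Finset.sum_insert, Finset.sum_singleton]
  · abel
  · simp [(X.r1 _).symm]
  · simp [(X.r1 _).symm, (X.r2 _).symm]
  · simp [(X.r1 _).symm, (X.r2 _).symm, (X.r3 _).symm]

/-- Local sum at vertices `a`,`b` of an e-invariant function that is `τ`-invariant elsewhere. -/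
theorem local_sum2 [Fintype D] [DecidableEq V] (X : XD e r q) {τ : D → D} (T : Turn r τ)
    (h : D → ZMod 2) (he : ∀ d, h (e d) = h d) (S : V → Prop) [DecidablePred S]
    (ht : ∀ d, ¬ S (q d) → h (τ d) = h d) :
    (∑ d, if S (q d) then h d else 0) = 0 := by
  have h1 := sum_inv2 X.ee X.ene h he
  have h2 : (∑ d, if S (q d) then 0 else h d) = 0 := by
    apply sum_inv2 T.tt (T.tne X)
    intro d
    simp only [T.qt X]
    split_ifs with hs
    · rfl
    · exact ht d hs
  have h3 : (∑ d, if S (q d) then h d else 0) + (∑ d, if S (q d) then 0 else h d) = ∑ d, h d := by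
    rw [← Finset.sum_add_distrib]
    refine Finset.sum_congr rfl fun d _ => ?_
    split_ifs <;> simp
  rw [h1, h2, add_zero] at h3
  exact h3

/-- Local sum at one vertex. -/
theorem local_sum [Fintype D] (X : XD e r q) {τ : D → D} (T : Turn r τ)
    (h : D → ZMod 2) (he : ∀ d, h (e d) = h d) (v : D)
    (ht : ∀ d, q d ≠ q v → h (τ d) = h d) :
    h v + h (τ v) + h (r (r v)) + h (r (r (τ v))) = 0 := by
  classical
  rw [← T.sum4 X, ← sum_fiber X]
  exact local_sum2 X T h he (fun w => w = q v) ht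

theorem local_sumpair [Fintype D] (X : XD e r q) {τ : D → D} (T : Turn r τ)
    (h : D → ZMod 2) (he : ∀ d, h (e d) = h d) (v w : D) (hvw : q v ≠ q w)
    (ht : ∀ d, q d ≠ q v → q d ≠ q w → h (τ d) = h d) :
    (h v + h (τ v) + h (r (r v)) + h (r (r (τ v)))) +
    (h w + h (τ w) + h (r (r w)) + h (r (r (τ w)))) = 0 := by
  classical
  rw [← T.sum4 X, ← sum_fiber X, ← T.sum4 X, ← sum_fiber X, ← Finset.sum_add_distrib]
  have := local_sum2 X T h he (fun u => u = q v ∨ u = q w) (by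
    intro d hd; push Not at hd; exact ht d hd.1 hd.2)
  refine Eq.trans (Finset.sum_congr rfl fun d _ => ?_) this
  by_cases h1 : q d = q v
  · simp [h1, hvw]
  · simp [h1]

theorem local_sumZ [Fintype D] (X : XD e r q) {τ : D → D} (T : Turn r τ)
    (h : D → ℤ) (he : ∀ d, h (e d) = - h d) (v : D)
    (ht : ∀ d, q d ≠ q v → h (τ d) = - h d) :
    h v + h (τ v) + h (r (r v)) + h (r (r (τ v))) = 0 := by
  classical
  rw [← T.sum4 X, ← sum_fiber X]
  have h1 := sum_invZ X.ee h he
  have h2 : (∑ d, if q d = q v then 0 else h d) = 0 := by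
    apply sum_invZ T.tt
    intro d
    simp only [T.qt X]
    split_ifs with hs
    · rfl
    · exact ht d hs
  have h3 : ∑ d, h d = (∑ d, if q d = q v then h d else 0) + ∑ d, if q d = q v then 0 else h d := by
    rw [← Finset.sum_add_distrib]
    refine Finset.sum_congr rfl fun d _ => ?_
    split_ifs <;> simp
  omega

/-- Switch the smoothing at a vertex. -/
def sw [DecidableEq V] (r : D → D) (q : D → V) (τ : D → D) (a : V) (x : D) : D :=
  if q x = a then r (r (τ x)) else τ x

theorem Turn.sw [DecidableEq V] (X : XD e r q) {τ : D → D} (T : Turn r τ) (a : V) :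
    Turn r (sw r q τ a) := by
  constructor
  · intro x
    unfold XG.sw
    split_ifs
    · rcases T.tr x with h | h <;> rw [h]
      · right; rfl
      · left; rw [X.r4]
    · exact T.tr x
  · intro x
    unfold XG.sw
    by_cases h : q x = a
    · simp only [h, if_true, X.qrr, T.qt X]
      rw [T.trr X, T.tt, X.r4]
    · simp only [h, if_false, T.qt X, T.tt]

end
end XG


namespace XG
section
variable {D V : Type} {e r : D → D} {q : D → V}

theorem exists_turn (X : XD e r q) : ∃ τ, Turn r τ := by
  classical
  let s := Function.surjInv X.qsurj
  have hs : ∀ v, q (s v) = v := Function.surjInv_eq X.qsurj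
  refine ⟨fun x => if x = s (q x) ∨ x = r (r (s (q x))) then r x else r (r (r x)), ?_, ?_⟩
  · intro x
    split_ifs <;> simp
  · intro x
    have h1 := X.r1
    have h2 := X.r2
    have h3 := X.r3
    have h4 := X.r4
    have hq := X.qr
    have := (X.qiff (s (q x)) x).1 (hs _)
    generalize hy : s (q x) = y at *
    rcases this with h | h | h | h <;> subst h <;> simp [hq, hy, h1, h2, h3, h4] <;> grind

/-- Invariant functions of a transition system are constant at vertices. -/
def Conn (e r : D → D) (τ : D → D) : Prop :=
  ∀ g : D → ZMod 2, (∀ d, g (e d) = g d) → (∀ d, g (τ d) = g d) → ∀ d, g (r (r d)) = g d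

theorem exists_conn [Fintype D] (X : XD e r q) : ∃ τ, Turn r τ ∧ Conn e r τ := by
  classical
  obtain ⟨τ, T⟩ := exists_turn X
  generalize hn : ({g : D → ZMod 2 | (∀ d, g (e d) = g d) ∧ (∀ d, g (τ d) = g d)}).ncard = n
  induction n using Nat.strong_induction_on generalizing τ with
  | _ n ih =>
    by_cases hc : Conn e r τ
    · exact ⟨τ, T, hc⟩
    · unfold Conn at hc
      push Not at hc
      obtain ⟨g, ge, gt, v, hv⟩ := hc
      refine ih _ ?_ (sw r q τ (q v)) (T.sw X _) rfl
      rw [← hn]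
      apply Set.ncard_lt_ncard _ (Set.toFinite _)
      constructor
      · rintro g' ⟨ge', gt'⟩
        refine ⟨ge', ?_⟩
        have key : ∀ d, q d ≠ q v → g' (τ d) = g' d := by
          intro d hd
          have := gt' d
          simpa [sw, hd] using this
        have hs := local_sum X T (fun d => g d * g' d) (by intro d; simp [ge, ge'])
          v (by intro d hd; simp [gt, key d hd])
        have k1 := gt' v
        have k2 := gt' (r (r v))
        simp only [sw, if_true, X.qrr, T.trr X, X.r4] at k1 k2
        have k3 := gt v
        have k4 := gt (r (r v))
        rw [T.trr X] at k4
        have k5 : g' (τ v) = g' v := by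
          simp only [k1, k2, k3, k4] at hs ⊢
          revert hs hv
          generalize g v = a; generalize g (r (r v)) = b
          generalize g' v = c; generalize g' (r (r v)) = d
          revert a b c d
          decide
        intro d
        by_cases hd : q d = q v
        · rcases T.q4 X hd with h | h | h | h <;> subst h
          · exact k5
          · rw [T.tt, k5]
          · rw [T.trr X, k1, ← k2, k5]
          · rw [T.trr X, T.tt, k1, ← k2, k5]
        · exact key d hd
      · intro hsub
        have := (hsub (show g ∈ _ from ⟨ge, gt⟩)).2 v
        simp only [sw, if_true] at this
        rw [← T.trr X, gt] at this
        exact hv this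

theorem exists_chi [Fintype D] [DecidableEq V] (X : XD e r q) {τ : D → D} (T : Turn r τ)
    (hc : Conn e r τ) (v : V) :
    ∃ χ : D → ZMod 2, (∀ x, χ (e x) = χ x) ∧ ∀ x, χ (τ x) = χ x + if q x = v then 1 else 0 := by
  classical
  let L : (D → ZMod 2) →ₗ[ZMod 2] (D → ZMod 2) × (D → ZMod 2) :=
    { toFun := fun χ => (fun d => χ d + χ (e d), fun d => χ d + χ (τ d))
      map_add' := by
        intro a b; ext d <;> simp <;> ring
      map_smul' := by
        intro c a; ext d <;> simp <;> ring }
  by_cases hm : ((0, fun d => if q d = v then 1 else 0) : (D → ZMod 2) × (D → ZMod 2)) ∈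
      LinearMap.range L
  · obtain ⟨χ, hχ⟩ := hm
    have h1 := congrArg Prod.fst hχ
    have h2 := congrArg Prod.snd hχ
    refine ⟨χ, fun x => ?_, fun x => ?_⟩
    · have := congrFun h1 x
      exact (z2_eq this).symm
    · have := congrFun h2 x
      change χ x + χ (τ x) = if q x = v then 1 else 0 at this
      rw [← this, ← add_assoc, z2_self, zero_add]
  · exfalso
    obtain ⟨f, hf, hle⟩ := Submodule.exists_le_ker_of_notMem hm
    have hL : ∀ d, f (Pi.single d 1, 0) + f (Pi.single (e d) 1, 0) +
        (f (0, Pi.single d 1) + f (0, Pi.single (τ d) 1)) = 0 := by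
      intro d
      have h1 : f (L (Pi.single d 1)) = 0 := hle ⟨_, rfl⟩
      have h2 : L (Pi.single d 1) = (Pi.single d 1, 0) + (Pi.single (e d) 1, 0) +
          ((0, Pi.single d 1) + (0, Pi.single (τ d) 1)) := by
        have e1 : ∀ x, e x = d ↔ x = e d := fun x => ⟨fun h => by rw [← h, X.ee], fun h => by rw [h, X.ee]⟩
        have e2 : ∀ x, τ x = d ↔ x = τ d := fun x => ⟨fun h => by rw [← h, T.tt], fun h => by rw [h, T.tt]⟩
        ext x <;> simp [L, Pi.single_apply, e1, e2]
      rw [h2, map_add, map_add, map_add] at h1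
      exact h1
    let lam : D → ZMod 2 := fun d => f (Pi.single d 1, 0)
    let mu : D → ZMod 2 := fun d => f (0, Pi.single d 1)
    have hL' : ∀ d, lam d + lam (e d) = mu d + mu (τ d) := fun d => z2_eq (hL d)
    obtain ⟨w, rfl⟩ := X.qsurj v
    have hg := hc (fun d => lam d + lam (e d)) (by intro d; simp only [X.ee]; ring)
      (by intro d; simp only [hL', T.tt]; ring) w
    simp only [hL', T.trr X] at hg
    apply hf
    have hsum : ((0, fun d => if q d = q w then 1 else 0) : (D → ZMod 2) × (D → ZMod 2)) =
        ∑ d, if q d = q w then (0, Pi.single d 1) else 0 := by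
      apply Prod.ext
      · rw [Prod.fst_sum]
        symm
        apply Finset.sum_eq_zero
        intro d _
        split_ifs <;> rfl
      · rw [Prod.snd_sum]
        ext x
        rw [Finset.sum_apply, Finset.sum_eq_single x]
        · split_ifs with hh <;> simp [hh]
        · intro b _ hb
          split_ifs <;> simp [hb.symm]
        · simp
    rw [hsum, map_sum]
    have : ∀ d, f (if q d = q w then (0, Pi.single d 1) else 0) = if q d = q w then mu d else 0 := by
      intro d
      split_ifs
      · rfl
      · exact map_zero f
    simp only [this]
    rw [sum_fiber X, T.sum4 X mu]
    rw [add_assoc, hg]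
    exact z2_self _

/-- A transition system together with its chord functions. -/
structure Good [DecidableEq V] (e r : D → D) (q : D → V) (τ : D → D) (χ : V → D → ZMod 2) :
    Prop where
  T : Turn r τ
  ce : ∀ v x, χ v (e x) = χ v x
  ct : ∀ v x, χ v (τ x) = χ v x + if q x = v then 1 else 0
  diag : ∀ x, χ (q x) (r (r x)) = χ (q x) x + 1

theorem obs_of_diag [DecidableEq V] (X : XD e r q) {τ : D → D} (T : Turn r τ) {χ : D → ZMod 2}
    {x : D} (ce : ∀ x, χ (e x) = χ x) (ct : ∀ y, χ (τ y) = χ y + if q y = q x then 1 else 0)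
    (hd : χ (r (r x)) = χ x) : Obs e r q := by
  have hz : InZ e r χ := by
    refine ⟨ce, fun d => ?_⟩
    rw [T.sum4 X, ← T.trr X, ct, ct, X.qrr]
    generalize (if q d = q x then (1 : ZMod 2) else 0) = c
    generalize χ d = a
    generalize χ (r (r d)) = b
    revert a b c
    decide
  have hz' : InZ e r (fun d => χ d + 1) := by
    refine ⟨fun d => by simp only [ce], fun d => ?_⟩
    have := hz.2 d
    revert this
    beta_reduce
    generalize χ d = a
    generalize χ (r d) = b
    generalize χ (r (r d)) = c
    generalize χ (r (r (r d))) = c'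
    revert a b c c'
    decide
  refine ⟨χ, _, hz, hz', ?_, ?_⟩
  · intro d
    generalize χ d = a
    revert a
    decide
  · have main : ∀ y, q y = q x → χ y = 1 → χ (r (r y)) = χ y → ∃ d, Pat r χ (fun d => χ d + 1) d ∧
      ∀ d', Pat r χ (fun d => χ d + 1) d' → q d' = q d := by
      intro y hy h1 h2
      refine ⟨y, ⟨h1, by rw [h2, h1], ?_, ?_⟩, ?_⟩
      · have a := ct y
        have b := ct (r (r y))
        rw [X.qrr, T.trr X, h2] at b
        rw [hy, if_pos rfl] at a b
        rcases T.tr y with h | h <;> rw [h] at a b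
        · simp only [a, h1]; decide
        · rw [X.r4 (r y)] at b; simp only [b, h1]; decide
      · have a := ct y
        have b := ct (r (r y))
        rw [X.qrr, T.trr X, h2] at b
        rw [hy, if_pos rfl] at a b
        rcases T.tr y with h | h <;> rw [h] at a b
        · simp only [b, h1]; decide
        · simp only [a, h1]; decide
      · rintro d ⟨p1, p2, p3, p4⟩
        by_contra hne
        have a := ct d
        rw [hy] at hne
        rw [if_neg hne, p1] at a
        rcases T.tr d with h | h <;> rw [h] at a
        · simp [a] at p3
        · simp [a] at p4
    rcases z2_cases (χ x) with h0 | h1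
    · have a := ct x
      have b := ct (r (r x))
      rw [X.qrr, if_pos rfl, hd] at b
      rw [if_pos rfl] at a
      apply main (τ x) (T.qt X x)
      · rw [a, h0, zero_add]
      · rw [← T.trr X, a, b]
    · exact main x rfl h1 hd

theorem exists_good [Fintype D] [DecidableEq V] (X : XD e r q) (ho : ¬ Obs e r q) :
    ∃ τ χ, Good e r q τ χ := by
  obtain ⟨τ, T, hc⟩ := exists_conn X
  choose χ h1 h2 using exists_chi X T hc
  refine ⟨τ, χ, T, h1, h2, fun x => ?_⟩
  by_contra hne
  apply ho
  refine obs_of_diag X T (x := x) (h1 (q x)) (h2 (q x)) ?_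
  revert hne
  generalize χ (q x) x = a
  generalize χ (q x) (r (r x)) = b
  revert a b
  decide

end
end XG


namespace XG
section
variable {D V : Type} {e r : D → D} {q : D → V}

/-- Interlacement numbers, computed with a section `s` of the vertex map. -/
def M (r : D → D) (s : V → D) (χ : V → D → ZMod 2) (u v : V) : ZMod 2 :=
  χ u (s v) + χ u (r (r (s v)))

theorem inZ_of (X : XD e r q) {τ : D → D} (T : Turn r τ) {F : D → ZMod 2}
    (he : ∀ d, F (e d) = F d)
    (h : ∀ d, (F (τ d) = F d ∧ F (r (r (τ d))) = F (r (r d))) ∨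
      (F (r (r d)) = F d ∧ F (r (r (τ d))) = F (τ d))) : InZ e r F := by
  refine ⟨he, fun d => ?_⟩
  rw [T.sum4 X]
  rcases h d with ⟨h1, h2⟩ | ⟨h1, h2⟩ <;> rw [h1, h2]
  · rw [z2_self, zero_add, z2_self]
  · rw [add_assoc, z2_self]

variable [DecidableEq V]

theorem Good.m_eq (X : XD e r q) {s : V → D} (hs : ∀ v, q (s v) = v) {τ : D → D}
    {χ : V → D → ZMod 2} (G : Good e r q τ χ) (u : V) (x : D) :
    χ u (r (r x)) = χ u x + M r s χ u (q x) := by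
  have h := G.T.q4 X (hs (q x))
  unfold M
  have t := G.ct u x
  have t' := G.ct u (r (r x))
  rw [X.qrr, G.T.trr X] at t'
  revert t t'
  generalize (if q x = u then (1 : ZMod 2) else 0) = c
  rcases h with h | h | h | h <;> rw [h]
  · generalize χ u x = a; generalize χ u (r (r x)) = b
    generalize χ u (τ x) = a'; generalize χ u (r (r (τ x))) = b'
    revert a b a' b' c; decide
  · generalize χ u x = a; generalize χ u (r (r x)) = b
    generalize χ u (τ x) = a'; generalize χ u (r (r (τ x))) = b'
    revert a b a' b' c; decide
  · rw [X.r4]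
    generalize χ u x = a; generalize χ u (r (r x)) = b
    generalize χ u (τ x) = a'; generalize χ u (r (r (τ x))) = b'
    revert a b a' b' c; decide
  · rw [X.r4]
    generalize χ u x = a; generalize χ u (r (r x)) = b
    generalize χ u (τ x) = a'; generalize χ u (r (r (τ x))) = b'
    revert a b a' b' c; decide

theorem Good.m_diag {s : V → D} (hs : ∀ v, q (s v) = v) {τ : D → D}
    {χ : V → D → ZMod 2} (G : Good e r q τ χ) (u : V) : M r s χ u u = 1 := by
  have := G.diag (s u)
  rw [hs] at this
  unfold M
  rw [this, ← add_assoc, z2_self, zero_add]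

theorem Good.m_symm [Fintype D] (X : XD e r q) {s : V → D} (hs : ∀ v, q (s v) = v) {τ : D → D}
    {χ : V → D → ZMod 2} (G : Good e r q τ χ) (u v : V) : M r s χ u v = M r s χ v u := by
  by_cases huv : u = v
  · rw [huv]
  have h := local_sumpair X G.T (fun d => χ u d * χ v d) (by intro d; simp [G.ce])
    (s u) (s v) (by rw [hs, hs]; exact huv) (by
      intro d h1 h2
      rw [hs] at h1 h2
      simp [G.ct, h1, h2])
  have a1 := G.ct u (s u)
  have a2 := G.ct u (r (r (s u)))
  have b1 := G.ct u (s v)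
  have b2 := G.ct u (r (r (s v)))
  have c1 := G.ct v (s u)
  have c2 := G.ct v (r (r (s u)))
  have d1 := G.ct v (s v)
  have d2 := G.ct v (r (r (s v)))
  have hvu : ¬ v = u := fun h => huv h.symm
  simp only [X.qrr, hs, G.T.trr X, if_true, if_neg huv, if_neg hvu] at a1 a2 b1 b2 c1 c2 d1 d2
  simp only [a1, a2, b1, b2, c1, c2, d1, d2] at h
  unfold M
  revert h
  generalize χ u (s u) = x1; generalize χ u (r (r (s u))) = x2
  generalize χ u (s v) = x3; generalize χ u (r (r (s v))) = x4
  generalize χ v (s u) = x5; generalize χ v (r (r (s u))) = x6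
  generalize χ v (s v) = x7; generalize χ v (r (r (s v))) = x8
  intro h
  apply z2_eq
  rw [← h]
  have e1 := z2_self (x1 * x5)
  have e2 := z2_self (x2 * x6)
  have e3 := z2_self (x3 * x7)
  have e4 := z2_self (x4 * x8)
  linear_combination -(e1 + e2 + e3 + e4)

theorem obs_of_triangle [Fintype D] (X : XD e r q) {s : V → D} (hs : ∀ v, q (s v) = v)
    {τ : D → D} {χ : V → D → ZMod 2} (G : Good e r q τ χ) {a b c : V}
    (hab : a ≠ b) (hbc : b ≠ c) (hac : a ≠ c) (mab : M r s χ a b = 1) (mbc : M r s χ b c = 1)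
    (mac : M r s χ a c = 1) : Obs e r q := by
  have T := G.T
  have mba : M r s χ b a = 1 := by rw [G.m_symm X hs, mab]
  have mcb : M r s χ c b = 1 := by rw [G.m_symm X hs, mbc]
  have mca : M r s χ c a = 1 := by rw [G.m_symm X hs, mac]
  have maa := G.m_diag hs a
  have mbb := G.m_diag hs b
  have mcc := G.m_diag hs c
  let k := χ b (s a) + χ c (s a)
  let α : D → ZMod 2 := fun d => χ a d + χ b d
  let β : D → ZMod 2 := fun d => χ b d + χ c d + k
  have αe : ∀ d, α (e d) = α d := fun d => by simp [α, G.ce]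
  have βe : ∀ d, β (e d) = β d := fun d => by simp [β, G.ce]
  have αt : ∀ d, α (τ d) = α d + ((if q d = a then 1 else 0) + (if q d = b then 1 else 0)) :=
    fun d => by simp only [α, G.ct]; ring
  have βt : ∀ d, β (τ d) = β d + ((if q d = b then 1 else 0) + (if q d = c then 1 else 0)) :=
    fun d => by simp only [β, G.ct]; ring
  have hrr : ∀ d, (q d = a ∨ q d = b ∨ q d = c) → α (r (r d)) = α d ∧ β (r (r d)) = β d := by
    intro d hd
    have h2 : (1 : ZMod 2) + 1 = 0 := rfl
    simp only [α, β, G.m_eq X hs]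
    rcases hd with h | h | h <;> simp only [h, maa, mba, mca, mab, mbb, mcb, mac, mbc, mcc] <;>
      constructor <;> linear_combination h2
  have hqr := X.qrr
  have hqt := T.qt X
  have hZ : ∀ F : ZMod 2 → ZMod 2 → ZMod 2, InZ e r (fun d => F (α d) (β d)) := by
    intro F
    apply inZ_of X T
    · intro d; simp only [αe, βe]
    · intro d
      by_cases hd : q d = a ∨ q d = b ∨ q d = c
      · right
        rw [(hrr d hd).1, (hrr d hd).2, (hrr (τ d) (by rwa [hqt])).1, (hrr (τ d) (by rwa [hqt])).2]
        simp
      · left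
        push Not at hd
        rw [← T.trr X]
        simp [αt, βt, hd, hqr]
  refine ⟨_, _, hZ (fun x y => (x + 1) * (y + 1)), hZ (fun x y => x * (y + 1)), ?_, ?_⟩
  · intro d
    generalize α d = x; generalize β d = y
    revert x y; decide
  · have key : ∃ x, q x = a ∧ α x = 0 ∧ β x = 0 := by
      have hb : β (s a) = 0 := by
        change k + k = 0
        exact z2_self k
      rcases z2_cases (α (s a)) with h | h
      · exact ⟨s a, hs a, h, hb⟩
      · refine ⟨τ (s a), by rw [hqt, hs], ?_, ?_⟩
        · rw [αt, hs, if_pos rfl, if_neg hab, h]; rfl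
        · rw [βt, hs, if_neg hab, if_neg hac, hb]; rfl
    obtain ⟨x, hx, ha, hb⟩ := key
    have hta : α (τ x) = 1 := by rw [αt, hx, if_pos rfl, if_neg hab, ha]; rfl
    have htb : β (τ x) = 0 := by rw [βt, hx, if_neg hab, if_neg hac, hb]; rfl
    have h1 := hrr x (Or.inl hx)
    have h2 := hrr (τ x) (Or.inl (by rw [hqt, hx]))
    rw [ha, hb] at h1
    rw [hta, htb] at h2
    refine ⟨x, ⟨?_, ?_, ?_, ?_⟩, ?_⟩
    · simp [ha, hb]
    · simp [h1]
    · rcases T.tr x with h | h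
      · rw [← h]; simp [hta, htb]
      · rw [h, X.r4 (r x)] at h2; simp [h2]
    · rcases T.tr x with h | h
      · rw [h] at h2; simp [h2]
      · rw [← h]; simp [hta, htb]
    · rintro d ⟨p1, p2, p3, p4⟩
      beta_reduce at p1 p2 p3 p4
      have pt : α (τ d) * (β (τ d) + 1) = 1 := by
        rcases T.tr d with h | h <;> rw [h] <;> assumption
      rw [αt, βt] at pt
      rw [hx]
      by_contra hne
      rw [if_neg hne] at pt
      by_cases hb' : q d = b
      · rw [if_pos hb', if_neg (by rw [hb']; exact hbc)] at pt
        revert p1 pt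
        generalize α d = x; generalize β d = y
        revert x y; decide
      · rw [if_neg hb'] at pt
        revert p1 pt
        generalize (if q d = c then (1 : ZMod 2) else 0) = z
        generalize α d = x; generalize β d = y
        revert x y z; decide

/-- chord functions after a pivot -/
def piv (r : D → D) (s : V → D) (χ : V → D → ZMod 2) (a b v : V) (x : D) : ZMod 2 :=
  if v = a then χ b x else if v = b then χ a x else
    χ v x + M r s χ v a * χ b x + M r s χ v b * χ a x

theorem Good.pivot [Fintype D] (X : XD e r q) {s : V → D} (hs : ∀ v, q (s v) = v)
    {τ : D → D} {χ : V → D → ZMod 2} (G : Good e r q τ χ) {a b : V}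
    (hab : a ≠ b) (mab : M r s χ a b = 1) :
    Good e r q (sw r q (sw r q τ a) b) (piv r s χ a b) := by
  have mba : M r s χ b a = 1 := by rw [G.m_symm X hs, mab]
  have maa := G.m_diag hs a
  have mbb := G.m_diag hs b
  have base : ∀ v x, χ v (sw r q (sw r q τ a) b x) = χ v x + (if q x = v then 1 else 0) +
      (if q x = a then M r s χ v a else 0) + (if q x = b then M r s χ v b else 0) := by
    intro v x
    unfold sw
    by_cases ha : q x = a
    · have hb : ¬ a = b := hab
      simp only [ha, if_neg hb, if_true, G.m_eq X hs, G.ct, G.T.qt X, add_zero]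
    · by_cases hb : q x = b
      · have hb' : ¬ b = a := fun h => hab h.symm
        simp only [hb, if_neg hb', if_true, G.m_eq X hs, G.ct, G.T.qt X, add_zero]
      · simp only [if_neg ha, if_neg hb, G.ct, add_zero]
  refine ⟨(G.T.sw X a).sw X b, ?_, ?_, ?_⟩
  · intro v x
    simp only [piv, G.ce]
  · intro v x
    unfold piv
    simp only [base]
    by_cases hva : v = a
    · subst hva
      simp only [if_true, mba, mbb]
      generalize (if q x = b then (1 : ZMod 2) else 0) = z
      generalize (if q x = v then (1 : ZMod 2) else 0) = y
      generalize χ b x = w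
      revert z y w; decide
    · by_cases hvb : v = b
      · subst hvb
        simp only [if_neg hva, if_true, mab, maa]
        generalize (if q x = a then (1 : ZMod 2) else 0) = z
        generalize (if q x = v then (1 : ZMod 2) else 0) = y
        generalize χ a x = w
        revert z y w; decide
      · simp only [if_neg hva, if_neg hvb, mab, mba, maa, mbb]
        have h1 : (if q x = a then M r s χ v a else 0) = M r s χ v a * (if q x = a then 1 else 0) := by
          split_ifs <;> simp
        have h2 : (if q x = b then M r s χ v b else 0) = M r s χ v b * (if q x = b then 1 else 0) := by
          split_ifs <;> simp
        rw [h1, h2]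
        generalize (if q x = a then (1 : ZMod 2) else 0) = z
        generalize (if q x = b then (1 : ZMod 2) else 0) = y
        have h2 : (1 : ZMod 2) + 1 = 0 := rfl
        linear_combination (M r s χ v a * z + M r s χ v b * y + M r s χ v a * y + M r s χ v b * z) * h2
  · intro x
    unfold piv
    by_cases hva : q x = a
    · simp only [hva, if_true, G.m_eq X hs, mba]
    · by_cases hvb : q x = b
      · simp only [hvb, if_neg hab.symm, if_true, G.m_eq X hs, mab]
      · simp only [if_neg hva, if_neg hvb, G.m_eq X hs, G.m_diag hs]
        rw [G.m_symm X hs b, G.m_symm X hs a]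
        have h2 : (1 : ZMod 2) + 1 = 0 := rfl
        linear_combination (M r s χ (q x) a * M r s χ (q x) b) * h2

theorem M_piv {s : V → D} {χ : V → D → ZMod 2} {a b u v : V} (h1 : u ≠ a) (h2 : u ≠ b) :
    M r s (piv r s χ a b) u v =
      M r s χ u v + M r s χ u a * M r s χ b v + M r s χ u b * M r s χ a v := by
  simp only [M, piv, if_neg h1, if_neg h2]
  ring

/-- adjacency in the interlacement graph -/
def Ad (r : D → D) (s : V → D) (χ : V → D → ZMod 2) (u v : V) : Prop := u ≠ v ∧ M r s χ u v = 1

theorem no_odd [Fintype D] (X : XD e r q) (ho : ¬ Obs e r q) {s : V → D} (hs : ∀ v, q (s v) = v)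
    (m : ℕ) (hm : Odd m) (τ : D → D) (χ : V → D → ZMod 2) (G : Good e r q τ χ) (w : ℕ → V)
    (hw : w m = w 0) (ha : ∀ i < m, Ad r s χ (w i) (w (i + 1))) : False := by
  induction m using Nat.strong_induction_on generalizing τ χ w with
  | _ m ih =>
    have sym : ∀ {u v}, Ad r s χ u v → Ad r s χ v u := by
      intro u v h
      exact ⟨h.1.symm, by rw [G.m_symm X hs]; exact h.2⟩
    have tri : ∀ {a b c}, Ad r s χ a b → Ad r s χ b c → Ad r s χ a c → False := by
      intro a b c h1 h2 h3
      exact ho (obs_of_triangle X hs G h1.1 h2.1 h3.1 h1.2 h2.2 h3.2)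
    obtain ⟨t, rfl⟩ := hm
    -- chords of the walk do not exist
    have chord : ∀ i j, j ≤ 2 * t + 1 → i + 2 ≤ j → j ≤ i + (2 * t + 1) - 2 →
        ¬ Ad r s χ (w i) (w j) := by
      intro i j hj h1 h2 hadj
      rcases Nat.even_or_odd (j - i) with hp | hp
      · obtain ⟨p, hp⟩ := hp
        refine ih (j - i + 1) (by omega) ⟨p, by omega⟩ τ χ G
          (fun k => if k ≤ j - i then w (i + k) else w i) ?_ ?_
        · simp
        · intro k hk
          by_cases hk' : k = j - i
          · subst hk'
            simp only [le_refl, if_true]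
            rw [if_neg (by omega), show i + (j - i) = j by omega]
            exact sym hadj
          · simp only [show k ≤ j - i by omega, show k + 1 ≤ j - i by omega, if_true]
            exact ha (i + k) (by omega)
      · obtain ⟨p, hp⟩ := hp
        refine ih (2 * t + 1 - (j - i) + 1) (by omega) ⟨t - p, by omega⟩ τ χ G
          (fun k => if k ≤ i then w k else w (k + (j - i) - 1)) ?_ ?_
        · simp only [Nat.zero_le, if_true]
          rw [if_neg (by omega), ← hw]
          congr 1
          omega
        · intro k hk
          by_cases hk' : k < i
          · simp only [show k ≤ i by omega, show k + 1 ≤ i by omega, if_true]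
            exact ha k (by omega)
          · by_cases hk2 : k = i
            · subst hk2
              simp only [le_refl, if_true]
              rw [if_neg (by omega), show k + 1 + (j - k) - 1 = j by omega]
              exact hadj
            · simp only [show ¬ k ≤ i by omega, show ¬ k + 1 ≤ i by omega, if_false]
              have := ha (k + (j - i) - 1) (by omega)
              rw [show k + (j - i) - 1 + 1 = k + 1 + (j - i) - 1 by omega] at this
              exact this
    rcases Nat.lt_or_ge t 2 with ht | ht
    · have : t = 0 ∨ t = 1 := by omega
      rcases this with rfl | rfl
      · exact (ha 0 (by norm_num)).1 hw.symm
      · have h2 := ha 2 (by norm_num)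
        norm_num at hw h2
        rw [hw] at h2
        exact tri (ha 0 (by norm_num)) (ha 1 (by norm_num)) (sym h2)
    · have n1 : ∀ i, 3 ≤ i → i ≤ 2 * t → ¬ Ad r s χ (w 1) (w i) := by
        intro i h1 h2
        exact chord 1 i (by omega) (by omega) (by omega)
      have n2 : ∀ i, 4 ≤ i → i ≤ 2 * t + 1 → ¬ Ad r s χ (w 2) (w i) := by
        intro i h1 h2
        exact chord 2 i (by omega) (by omega) (by omega)
      have a12 : Ad r s χ (w 1) (w 2) := ha 1 (by omega)
      have a23 : Ad r s χ (w 2) (w 3) := ha 2 (by omega)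
      have a01 : Ad r s χ (w 0) (w 1) := ha 0 (by omega)
      have ne1 : ∀ i, 3 ≤ i → i ≤ 2 * t + 1 → w i ≠ w 1 := by
        intro i h1 h2 heq
        by_cases h3 : i = 3
        · subst h3
          apply n1 4 (by omega) (by omega)
          rw [← heq]
          exact ha 3 (by omega)
        · apply n2 i (by omega) h2
          rw [heq]
          exact sym a12
      have ne2 : ∀ i, 3 ≤ i → i ≤ 2 * t + 1 → w i ≠ w 2 := by
        intro i h1 h2 heq
        by_cases h3 : i = 2 * t + 1
        · apply n2 (2 * t) (by omega) (by omega)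
          rw [← heq, h3]
          exact sym (ha (2 * t) (by omega))
        · apply n1 i h1 (by omega)
          rw [heq]
          exact a12
      have m1 : ∀ i, 3 ≤ i → i ≤ 2 * t → M r s χ (w 1) (w i) = 0 := by
        intro i h1 h2
        rcases z2_cases (M r s χ (w 1) (w i)) with h | h
        · exact h
        · exact absurd ⟨(ne1 i h1 (by omega)).symm, h⟩ (n1 i h1 h2)
      have m2 : ∀ i, 4 ≤ i → i ≤ 2 * t + 1 → M r s χ (w 2) (w i) = 0 := by
        intro i h1 h2
        rcases z2_cases (M r s χ (w 2) (w i)) with h | h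
        · exact h
        · exact absurd ⟨(ne2 i (by omega) h2).symm, h⟩ (n2 i h1 h2)
      have ne30 : w 3 ≠ w 0 := by
        intro heq
        apply n2 (2 * t + 1) (by omega) (by omega)
        rw [hw, ← heq]
        exact a23
      have m03 : M r s χ (w 0) (w 3) = 0 := by
        rcases z2_cases (M r s χ (w 0) (w 3)) with h | h
        · exact h
        · exact absurd ⟨ne30.symm, h⟩ (chord 0 3 (by omega) (by omega) (by omega))
      have G' := G.pivot X hs a12.1 a12.2
      refine ih (2 * t + 1 - 2) (by omega) ⟨t - 1, by omega⟩ _ _ G'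
        (fun k => if k < 2 * t - 1 then w (k + 3) else w 3) ?_ ?_
      · simp only [show ¬ (2 * t + 1 - 2 < 2 * t - 1) by omega, if_false,
          show 0 < 2 * t - 1 by omega, if_true]
      · intro k hk
        have hk1 : k < 2 * t - 1 := by omega
        simp only [hk1, if_true]
        by_cases hk2 : k = 2 * t - 2
        · have hk3 : k + 3 = 2 * t + 1 := by omega
          rw [if_neg (by omega), hk3]
          constructor
          · rw [hw]; exact ne30.symm
          · rw [M_piv (ne1 _ (by omega) (by omega)) (ne2 _ (by omega) (by omega)),
              G.m_symm X hs (w (2 * t + 1)) (w 2), m2 (2 * t + 1) (by omega) (by omega), hw, m03, a01.2, a23.2]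
            simp
        · rw [if_pos (by omega)]
          constructor
          · exact (ha (k + 3) (by omega)).1
          · rw [M_piv (ne1 _ (by omega) (by omega)) (ne2 _ (by omega) (by omega)),
              G.m_symm X hs _ (w 1), m1 _ (by omega) (by omega), m2 (k + 1 + 3) (by omega) (by omega),
              show k + 1 + 3 = k + 3 + 1 by omega, (ha (k + 3) (by omega)).2]
            by_cases hk4 : k = 0
            · subst hk4
              rw [m1 _ (by omega) (by omega)]
              simp
            · rw [G.m_symm X hs _ (w 2), m2 _ (by omega) (by omega)]
              simp

theorem exists_coloring [Fintype D] (X : XD e r q) (ho : ¬ Obs e r q) {s : V → D}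
    (hs : ∀ v, q (s v) = v) : ∃ τ χ, Good e r q τ χ ∧ ∃ c : V → ZMod 2,
      ∀ u v, u ≠ v → c u = c v → M r s χ u v = 0 := by
  obtain ⟨τ, χ, G⟩ := exists_good X ho
  refine ⟨τ, χ, G, ?_⟩
  let H : SimpleGraph V :=
    { Adj := Ad r s χ
      symm := ⟨fun u v h => ⟨h.1.symm, by rw [G.m_symm X hs]; exact h.2⟩⟩
      loopless := ⟨fun u h => h.1 rfl⟩ }
  have hcol : H.Colorable 2 := by
    rw [SimpleGraph.two_colorable_iff_forall_loop_even]
    intro u w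
    by_contra hodd
    rw [Nat.not_even_iff_odd] at hodd
    refine no_odd X ho hs w.length hodd τ χ G w.getVert ?_ ?_
    · rw [w.getVert_length, w.getVert_zero]
    · intro i hi
      exact w.adj_getVert_succ hi
  obtain ⟨C⟩ := hcol
  refine ⟨fun v => (C v : Fin 2), ?_⟩
  intro u v huv hc
  rcases z2_cases (M r s χ u v) with h | h
  · exact h
  · exact absurd hc (C.valid (show H.Adj u v from ⟨huv, h⟩))

end
end XG


namespace XG
section
variable {D V : Type} {e r : D → D} {q : D → V}

theorem dihedral {e σ : D → D} (ee : ∀ d, e (e d) = d) (ene : ∀ d, e d ≠ d)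
    (ss : ∀ d, σ (σ d) = d) (sne : ∀ d, σ d ≠ d) (n : ℕ) :
    ∀ x, (fun d => σ (e d))^[n] x ≠ e x := by
  induction n using Nat.twoStepInduction with
  | zero => intro x h; exact ene x h.symm
  | one => intro x h; exact sne _ h
  | more n ih _ =>
    intro x h
    rw [Function.iterate_succ_apply, Function.iterate_succ_apply'] at h
    apply ih (σ (e x))
    have h2 := congrArg σ h
    rw [ss] at h2
    have h3 := congrArg e h2
    rw [ee] at h3
    exact h3

theorem exists_orient [Fintype D] {e τ : D → D} (ee : ∀ d, e (e d) = d) (ene : ∀ d, e d ≠ d)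
    (ss : ∀ d, τ (τ d) = d) (sne : ∀ d, τ d ≠ d) :
    ∃ o : D → ZMod 2, (∀ d, o (e d) = o d + 1) ∧ ∀ d, o (τ d) = o d + 1 := by
  classical
  let p : Equiv.Perm D := ⟨fun d => τ (e d), fun d => e (τ d), fun d => by simp [ss, ee],
    fun d => by simp [ss, ee]⟩
  let Q := Quotient (Equiv.Perm.SameCycle.setoid p)
  let cyc : D → Q := fun d => Quotient.mk _ d
  let idx : Q ≃ Fin (Nat.card Q) := Finite.equivFin Q
  have hp : ∀ d, cyc (p d) = cyc d := fun d =>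
    Quotient.sound (s := Equiv.Perm.SameCycle.setoid p)
      ((Equiv.Perm.sameCycle_apply_left).2 (Equiv.Perm.SameCycle.refl p d))
  have hne : ∀ d, idx (cyc d) ≠ idx (cyc (e d)) := by
    intro d h
    have h1 : p.SameCycle d (e d) := Quotient.exact (idx.injective h)
    obtain ⟨n, hn⟩ := h1.exists_nat_pow_eq
    apply dihedral ee ene ss sne n d
    rw [← hn]
    have : ⇑(p ^ n) = (⇑p)^[n] := Equiv.Perm.coe_pow p n
    rw [this]
    rfl
  refine ⟨fun d => if idx (cyc d) < idx (cyc (e d)) then 1 else 0, ?_, ?_⟩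
  · intro d
    simp only [ee]
    rcases lt_trichotomy (idx (cyc d)) (idx (cyc (e d))) with h | h | h
    · rw [if_neg (not_lt.2 h.le), if_pos h]; rfl
    · exact absurd h (hne d)
    · rw [if_pos h, if_neg (not_lt.2 h.le)]; rfl
  · intro d
    have h1 : cyc (τ d) = cyc (e d) := by
      rw [← hp (e d)]; simp [p, ee]
    have h2 : cyc (e (τ d)) = cyc d := by
      rw [← hp (e (τ d))]; simp [p, ee, ss]
    simp only [h1, h2]
    rcases lt_trichotomy (idx (cyc d)) (idx (cyc (e d))) with h | h | h
    · rw [if_neg (not_lt.2 h.le), if_pos h]; rfl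
    · exact absurd h (hne d)
    · rw [if_pos h, if_neg (not_lt.2 h.le)]; rfl

variable [DecidableEq V]

theorem Good.orient_rr [Fintype D] (X : XD e r q) {τ : D → D} {χ : V → D → ZMod 2}
    (G : Good e r q τ χ) {o : D → ZMod 2} (oe : ∀ d, o (e d) = o d + 1)
    (ot : ∀ d, o (τ d) = o d + 1) (d : D) : o (r (r d)) = o d := by
  let F : ZMod 2 → ZMod 2 → ℤ := fun a b => if a = 1 then (if b = 1 then 1 else -1) else 0
  have hF : ∀ a b, F a (b + 1) = - F a b := by decide
  have h := local_sumZ X G.T (fun x => F (χ (q d) x) (o x)) (by intro x; simp [G.ce, oe, hF]) d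
    (by intro x hx; simp [G.ct, hx, ot, hF])
  beta_reduce at h
  have h1 := G.ct (q d) (r (r d))
  have h2 := ot (r (r d))
  rw [G.T.trr X, X.qrr] at h1
  rw [G.T.trr X] at h2
  rw [h1, h2, ot, G.ct, G.diag, if_pos rfl] at h
  revert h
  generalize χ (q d) d = a; generalize o d = b; generalize o (r (r d)) = c
  revert a b c
  decide

theorem exists_rho [Fintype D] [Fintype V] (X : XD e r q) (ho : ¬ Obs e r q) :
    ∃ ρ : D → D, (∀ d, (∀ y, q y = q d → ρ y = r y) ∨ (∀ y, q y = q d → ρ y = r (r (r y)))) ∧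
      ∀ ψ, InZ e r ψ → ∃ φ : D → ZMod 2, (∀ x, φ (ρ x) = φ (e x)) ∧ ∀ x, φ x + φ (e x) = ψ x := by
  let s := Function.surjInv X.qsurj
  have hs : ∀ v, q (s v) = v := Function.surjInv_eq X.qsurj
  obtain ⟨τ, χ, G, c, hc⟩ := exists_coloring X ho hs
  have T := G.T
  obtain ⟨o, oe, ot⟩ := exists_orient X.ee X.ene T.tt (T.tne X)
  have orr := G.orient_rr X oe ot
  refine ⟨fun x => if o x = c (q x) then τ x else r (r (τ x)), ?_, ?_⟩
  · intro d
    have key : ∀ d, o d = c (q d) → (∀ y, q y = q d →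
        (if o y = c (q y) then τ y else r (r (τ y))) = r y) ∨ (∀ y, q y = q d →
        (if o y = c (q y) then τ y else r (r (τ y))) = r (r (r y))) := by
      intro d hd
      have hne : ¬ o d + 1 = o d := by generalize o d = a; revert a; decide
      rcases T.tr d with h | h
      · left
        intro y hy
        rcases T.q4 X hy with rfl | rfl | rfl | rfl
        · simp only [hd, if_true, h]
        · simp only [T.qt X, ot, ← hd, if_neg hne, T.tt]
          rw [h]
        · simp only [X.qrr, orr, hd, if_true, T.trr X, h]
        · simp only [X.qrr, orr, T.qt X, ot, ← hd, if_neg hne, T.trr X, T.tt, X.r4]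
          rw [h, X.r4]
      · right
        have h' : r (τ d) = d := by rw [h, X.r4]
        intro y hy
        rcases T.q4 X hy with rfl | rfl | rfl | rfl
        · simp only [hd, if_true, h]
        · simp only [T.qt X, ot, ← hd, if_neg hne, T.tt, h']
        · simp only [X.qrr, orr, hd, if_true, T.trr X, h]
        · simp only [X.qrr, orr, T.qt X, ot, ← hd, if_neg hne, T.trr X, T.tt, X.r4]
          rw [h']
    by_cases hd : o d = c (q d)
    · exact key d hd
    · have := key (τ d) (by
        rw [T.qt X, ot]
        revert hd; generalize o d = a; generalize c (q d) = b; revert a b; decide)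
      rwa [T.qt X] at this
  · intro ψ hψ
    -- coefficients
    let k : V → ZMod 2 := fun v => ψ (s v) + ψ (τ (s v))
    have hk : ∀ x, ψ (τ x) = ψ x + k (q x) := by
      intro x
      have h0 := hψ.2 x
      rw [T.sum4 X] at h0
      have hsx := T.q4 X (hs (q x))
      simp only [k]
      revert h0
      rcases hsx with h | h | h | h <;> rw [h]
      · generalize ψ x = a; generalize ψ (τ x) = b; 
        generalize ψ (r (r x)) = a'; generalize ψ (r (r (τ x))) = b'
        revert a b a' b'; decide
      · rw [T.tt]
        generalize ψ x = a; generalize ψ (τ x) = b; 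
        generalize ψ (r (r x)) = a'; generalize ψ (r (r (τ x))) = b'
        revert a b a' b'; decide
      · rw [T.trr X]
        generalize ψ x = a; generalize ψ (τ x) = b
        generalize ψ (r (r x)) = a'; generalize ψ (r (r (τ x))) = b'
        revert a b a' b'; decide
      · rw [T.trr X, T.tt]
        generalize ψ x = a; generalize ψ (τ x) = b
        generalize ψ (r (r x)) = a'; generalize ψ (r (r (τ x))) = b'
        revert a b a' b'; decide
    let g : D → ZMod 2 := fun x => ψ x + ∑ v, k v * χ v x
    have ge : ∀ x, g (e x) = g x := by intro x; simp only [g, hψ.1, G.ce]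
    have gt : ∀ x, g (τ x) = g x := by
      intro x
      simp only [g, hk, G.ct, mul_add, Finset.sum_add_distrib, mul_ite, mul_one, mul_zero,
        Finset.sum_ite_eq, Finset.mem_univ, if_true]
      have := z2_self (k (q x))
      linear_combination this
    have grr : ∀ x, g (r (r x)) = g x := by
      intro x
      have h := local_sum X T (fun y => g y * χ (q x) y) (by intro d; simp [ge, G.ce]) x
        (by intro d hd; simp [gt, G.ct, hd])
      have h1 := gt (r (r x))
      have h2 := G.ct (q x) (r (r x))
      rw [T.trr X] at h1 h2
      simp only [h1, h2, gt, G.ct, X.qrr, if_true] at h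
      revert h
      generalize g x = a; generalize g (r (r x)) = b
      generalize χ (q x) x = a'; generalize χ (q x) (r (r x)) = b'
      revert a b a' b'; decide
    let I : ZMod 2 → ZMod 2 → ZMod 2 := fun a b => if a = b then 1 else 0
    have hI : ∀ a b, I a b + I (a + 1) b = 1 := by decide
    have hI0 : ∀ a b, a ≠ b → I a b = 0 := by decide
    have hrho : ∀ x, o (if o x = c (q x) then τ x else r (r (τ x))) = o x + 1 := by
      intro x
      split_ifs <;> simp [orr, ot]
    refine ⟨fun x => I (o x) 0 * g x + ∑ v, k v * (I (o x) (c v) * χ v x), ?_, ?_⟩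
    · intro x
      simp only [hrho, oe, ge, G.ce]
      congr 1
      · congr 1
        split_ifs <;> simp [grr, gt]
      · refine Finset.sum_congr rfl fun v _ => ?_
        congr 1
        by_cases hov : o x + 1 = c v
        · congr 1
          by_cases hx : o x = c (q x)
          · have hne : q x ≠ v := by
              rintro rfl
              rw [← hx] at hov
              revert hov; generalize o x = a; revert a; decide
            rw [if_pos hx, G.ct, if_neg hne, add_zero]
          · rw [if_neg hx, G.m_eq X hs, G.ct, T.qt X]
            by_cases hv : q x = v
            · subst hv
              rw [if_pos rfl, G.m_diag hs, add_assoc, z2_self, add_zero]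
            · rw [if_neg hv, hc v (q x) (fun h => hv h.symm), add_zero, add_zero]
              rw [← hov]
              revert hx; generalize o x = a; generalize c (q x) = b; revert a b; decide
        · rw [hI0 _ _ hov, zero_mul, zero_mul]
    · intro x
      simp only [oe, ge, G.ce]
      have h1 : ∀ v, k v * (I (o x) (c v) * χ v x) + k v * (I (o x + 1) (c v) * χ v x) = k v * χ v x := by
        intro v
        have := hI (o x) (c v)
        linear_combination (k v * χ v x) * this
      have h2 := hI (o x) 0
      have h3 : (∑ v, k v * (I (o x) (c v) * χ v x)) + (∑ v, k v * (I (o x + 1) (c v) * χ v x)) =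
          ∑ v, k v * χ v x := by
        rw [← Finset.sum_add_distrib]
        exact Finset.sum_congr rfl fun v _ => h1 v
      have h4 : g x = ψ x + ∑ v, k v * χ v x := rfl
      have h5 := z2_self (∑ v, k v * χ v x)
      linear_combination h2 * g x + h3 + h4 + h5

end
end XG


namespace XG

theorem xd_of_reg (G : StarGraph) (hreg : ∀ d : G.D, G.degree d = 4) :
    XD (fun d => G.edgeInv d) (fun d => G.rot d)
      (fun d => (Quotient.mk (Equiv.Perm.SameCycle.setoid G.rot) d)) := by
  have hper : ∀ x : G.D, Function.minimalPeriod G.rot x = 4 := by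
    intro x
    rw [← hreg x]
    have hp : 0 < Function.minimalPeriod G.rot x :=
      Function.minimalPeriod_pos_of_mem_periodicPts
        (Function.Injective.mem_periodicPts G.rot.injective x)
    symm
    unfold StarGraph.degree
    let f : Fin (Function.minimalPeriod G.rot x) → {e : G.D // G.SameVertex x e} :=
      fun i => ⟨(G.rot)^[i.val] x, ⟨i.val, by
        rw [zpow_natCast, Equiv.Perm.iterate_eq_pow]⟩⟩
    have hf : Function.Bijective f := by
      constructor
      · intro i j hij
        have := congrArg Subtype.val hij
        exact Fin.ext ((Function.iterate_eq_iterate_iff_of_lt_minimalPeriod i.2 j.2).1 this)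
      · rintro ⟨y, hy⟩
        obtain ⟨i, _, hi⟩ := Equiv.Perm.SameCycle.exists_pow_eq' hy
        refine ⟨⟨i % Function.minimalPeriod G.rot x, Nat.mod_lt _ hp⟩, Subtype.ext ?_⟩
        show (G.rot)^[i % Function.minimalPeriod G.rot x] x = y
        rw [Function.iterate_mod_minimalPeriod_eq, Equiv.Perm.iterate_eq_pow]
        exact hi
    rw [← Nat.card_congr (Equiv.ofBijective f hf), Nat.card_fin]
  have h4 : ∀ d, G.rot (G.rot (G.rot (G.rot d))) = d := by
    intro d
    have := Function.iterate_minimalPeriod (f := G.rot) (x := d)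
    rw [hper d] at this
    exact this
  have hlt : ∀ d, ∀ n, 0 < n → n < 4 → (G.rot)^[n] d ≠ d := by
    intro d n h0 h1 h
    have := (Function.iterate_eq_iterate_iff_of_lt_minimalPeriod (f := G.rot) (x := d) (m := n) (n := 0)
      (by rw [hper]; exact h1) (by rw [hper]; omega)).1 h
    omega
  refine ⟨G.edgeInv_invol, G.edgeInv_ne, h4, fun d => hlt d 1 (by omega) (by omega),
    fun d => hlt d 2 (by omega) (by omega), ?_, Quotient.mk_surjective⟩
  intro x y
  rw [Quotient.eq]
  constructor
  · intro h
    obtain ⟨i, _, hi⟩ := Equiv.Perm.SameCycle.exists_pow_eq' h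
    rw [← Equiv.Perm.iterate_eq_pow, ← Function.iterate_mod_minimalPeriod_eq, hper] at hi
    have : i % 4 < 4 := Nat.mod_lt _ (by omega)
    interval_cases i % 4
    · exact Or.inl hi.symm
    · exact Or.inr (Or.inl hi.symm)
    · exact Or.inr (Or.inr (Or.inl hi.symm))
    · exact Or.inr (Or.inr (Or.inr hi.symm))
  · rintro (h | h | h | h)
    · exact ⟨0, by simp [h]⟩
    · exact ⟨1, by simp [h]⟩
    · exact ⟨2, by rw [h]; rfl⟩
    · exact ⟨3, by rw [h]; rfl⟩

end XG


namespace XG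

open Module

theorem finrank_setoid {D : Type} [Finite D] (S : Setoid D) (P : Submodule (ZMod 2) (D → ZMod 2))
    (hP : ∀ φ, φ ∈ P ↔ ∀ a b, S a b → φ a = φ b) : finrank (ZMod 2) P = Nat.card (Quotient S) := by
  classical
  have hinj : Function.Injective (LinearMap.funLeft (ZMod 2) (ZMod 2) (Quotient.mk S)) :=
    LinearMap.funLeft_injective_of_surjective _ _ _ Quotient.mk_surjective
  have hr : LinearMap.range (LinearMap.funLeft (ZMod 2) (ZMod 2) (Quotient.mk S)) = P := by
    ext φ
    rw [hP, LinearMap.mem_range]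
    constructor
    · rintro ⟨f, rfl⟩ a b hab
      simp only [LinearMap.funLeft_apply]
      rw [Quotient.sound hab]
    · intro h
      exact ⟨Quotient.lift φ h, by ext x; simp [LinearMap.funLeft_apply]⟩
  have : Fintype (Quotient S) := Fintype.ofFinite _
  rw [← hr, LinearMap.finrank_range_of_inj hinj, Module.finrank_fintype_fun_eq_card,
    Nat.card_eq_fintype_card]

section
variable {D V : Type} {e r : D → D} {q : D → V}

/-- `φ ↦ φ + φ ∘ e` -/
def dl (e : D → D) : (D → ZMod 2) →ₗ[ZMod 2] (D → ZMod 2) :=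
  LinearMap.id + LinearMap.funLeft (ZMod 2) (ZMod 2) e

theorem dl_apply (e : D → D) (φ : D → ZMod 2) (x : D) : dl e φ x = φ x + φ (e x) := rfl

/-- functions invariant under `g` -/
def inv (g : D → D) : Submodule (ZMod 2) (D → ZMod 2) where
  carrier := {φ | ∀ x, φ (g x) = φ x}
  add_mem' := by intro a b ha hb x; simp only [Pi.add_apply]; rw [ha x, hb x]
  zero_mem' := by intro x; rfl
  smul_mem' := by intro c a ha x; simp only [Pi.smul_apply]; rw [ha x]

theorem mem_inv (g : D → D) (φ : D → ZMod 2) : φ ∈ inv g ↔ ∀ x, φ (g x) = φ x := Iff.rfl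

theorem ker_dl (e : D → D) : LinearMap.ker (dl e) = inv e := by
  ext φ
  rw [LinearMap.mem_ker, mem_inv, funext_iff]
  refine forall_congr' fun x => ?_
  rw [dl_apply]
  constructor
  · intro h; exact (z2_eq h).symm
  · intro h; rw [h]; exact z2_self _

theorem range_dl [Fintype D] (ee : ∀ d, e (e d) = d) (ene : ∀ d, e d ≠ d) :
    LinearMap.range (dl e) = inv e := by
  obtain ⟨o, ho, -⟩ := exists_orient (τ := e) ee ene ee ene
  ext φ
  rw [LinearMap.mem_range, mem_inv]
  constructor
  · rintro ⟨f, rfl⟩ x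
    simp only [dl_apply, ee]; rw [add_comm]
  · intro h
    refine ⟨fun d => o d * φ d, ?_⟩
    ext x
    rw [dl_apply, ho, h]
    have : o x * φ x + (o x + 1) * φ x = (o x * φ x + o x * φ x) + φ x := by ring
    rw [this, z2_self, zero_add]

theorem edges_dim [Fintype D] (ee : ∀ d, e (e d) = d) (ene : ∀ d, e d ≠ d) :
    Fintype.card D = 2 * finrank (ZMod 2) (inv e) := by
  have h := LinearMap.finrank_range_add_finrank_ker (dl e)
  rw [range_dl ee ene, ker_dl, Module.finrank_fintype_fun_eq_card] at h
  omega

theorem finrank_map_inj {M N : Type} [AddCommGroup M] [AddCommGroup N] [Module (ZMod 2) M]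
    [Module (ZMod 2) N] {f : M →ₗ[ZMod 2] N} (hf : Function.Injective f)
    (P : Submodule (ZMod 2) M) :
    finrank (ZMod 2) (P.map f) = finrank (ZMod 2) P :=
  (LinearEquiv.finrank_eq (Submodule.equivMapOfInjective f hf P)).symm

theorem finrank_map {M N : Type} [AddCommGroup M] [AddCommGroup N] [Module (ZMod 2) M]
    [Module (ZMod 2) N] [FiniteDimensional (ZMod 2) M] (f : M →ₗ[ZMod 2] N) (P : Submodule (ZMod 2) M) :
    finrank (ZMod 2) (P.map f) + finrank (ZMod 2) (P ⊓ LinearMap.ker f : Submodule (ZMod 2) M) =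
      finrank (ZMod 2) P := by
  have h := LinearMap.finrank_range_add_finrank_ker (f.domRestrict P)
  rw [LinearMap.range_domRestrict, LinearMap.ker_domRestrict] at h
  rw [← h]
  congr 1
  have : P ⊓ LinearMap.ker f = ((LinearMap.ker f).submoduleOf P).map P.subtype := by
    rw [Submodule.submoduleOf, Submodule.map_comap_subtype]
  rw [this]
  exact finrank_map_inj P.subtype_injective _

/-- boundary map -/
def bd [Fintype D] [DecidableEq V] (q : D → V) : (D → ZMod 2) →ₗ[ZMod 2] (V → ZMod 2) where
  toFun ψ v := ∑ d, if q d = v then ψ d else 0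
  map_add' a b := by
    ext v
    simp only [Pi.add_apply, ← Finset.sum_add_distrib]
    refine Finset.sum_congr rfl fun d _ => ?_
    split_ifs <;> simp
  map_smul' c a := by
    ext v
    simp only [Pi.smul_apply, smul_eq_mul, Finset.mul_sum, RingHom.id_apply]
    refine Finset.sum_congr rfl fun d _ => ?_
    split_ifs <;> simp

theorem mem_Z [Fintype D] [DecidableEq V] (X : XD e r q) (ψ : D → ZMod 2) :
    ψ ∈ inv e ⊓ LinearMap.ker (bd q) ↔ InZ e r ψ := by
  rw [Submodule.mem_inf, mem_inv, LinearMap.mem_ker]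
  unfold InZ
  refine and_congr Iff.rfl ?_
  constructor
  · intro h d
    rw [← sum_fiber X]
    exact congrFun h (q d)
  · intro h
    ext v
    obtain ⟨d, rfl⟩ := X.qsurj v
    have := h d
    rw [← sum_fiber X] at this
    exact this

/-- incidence matrix -/
def inc [DecidableEq V] (e : D → D) (q : D → V) : Matrix V D (ZMod 2) :=
  fun v d => (if q d = v then 1 else 0) + (if q (e d) = v then 1 else 0)

theorem finrank_bd [Fintype D] [Fintype V] [DecidableEq V] (X : XD e r q) :
    finrank (ZMod 2) ((inv e).map (bd q)) + finrank (ZMod 2) (inv r ⊓ inv e : Submodule (ZMod 2) _) =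
      Fintype.card V := by
  have h0 : (inv e).map (bd q) = LinearMap.range ((bd q) ∘ₗ (dl e)) := by
    rw [← range_dl X.ee X.ene, ← LinearMap.range_comp]
  have h1 : (bd q) ∘ₗ (dl e) = (inc e q).mulVecLin := by
    refine LinearMap.ext fun φ => ?_
    ext v
    rw [LinearMap.comp_apply, Matrix.mulVecLin_apply]
    show (∑ d, if q d = v then φ d + φ (e d) else 0) =
      ∑ d, ((if q d = v then 1 else 0) + (if q (e d) = v then 1 else 0)) * φ d
    have hA : (∑ d, if q d = v then φ d + φ (e d) else 0) =
        (∑ d, if q d = v then φ d else 0) + ∑ d, if q d = v then φ (e d) else 0 := by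
      rw [← Finset.sum_add_distrib]
      refine Finset.sum_congr rfl fun d _ => ?_
      split_ifs <;> simp
    have hB : (∑ d, if q d = v then φ (e d) else 0) = ∑ d, if q (e d) = v then φ d else 0 := by
      refine Fintype.sum_equiv (⟨e, e, X.ee, X.ee⟩ : D ≃ D) _ _ (fun d => ?_)
      simp [X.ee]
    rw [hA, hB, ← Finset.sum_add_distrib]
    refine Finset.sum_congr rfl fun d _ => ?_
    split_ifs <;> simp [add_mul]
  have h2 : finrank (ZMod 2) (LinearMap.range (inc e q).mulVecLin) =
      finrank (ZMod 2) (LinearMap.range (inc e q).transpose.mulVecLin) :=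
    (Matrix.rank_transpose (inc e q)).symm
  rw [h0, h1, h2]
  have h3 := LinearMap.finrank_range_add_finrank_ker ((inc e q).transpose.mulVecLin)
  rw [Module.finrank_fintype_fun_eq_card] at h3
  rw [← h3]
  congr 1
  have hinj : Function.Injective (LinearMap.funLeft (ZMod 2) (ZMod 2) q) :=
    LinearMap.funLeft_injective_of_surjective _ _ _ X.qsurj
  rw [← finrank_map_inj hinj]
  have hk : ∀ f : V → ZMod 2, f ∈ LinearMap.ker (inc e q).transpose.mulVecLin ↔
      ∀ d, f (q (e d)) = f (q d) := by
    intro f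
    rw [LinearMap.mem_ker, funext_iff]
    refine forall_congr' fun d => ?_
    rw [Matrix.mulVecLin_apply]
    show (∑ v, ((if q d = v then 1 else 0) + (if q (e d) = v then 1 else 0)) * f v) = 0 ↔ _
    have : (∑ v, ((if q d = v then 1 else 0) + (if q (e d) = v then 1 else 0)) * f v) =
        f (q d) + f (q (e d)) := by
      simp [add_mul, Finset.sum_add_distrib]
    rw [this]
    constructor
    · intro h; exact (z2_eq h).symm
    · intro h; rw [h]; exact z2_self _
  have hE : inv r ⊓ inv e = Submodule.map (LinearMap.funLeft (ZMod 2) (ZMod 2) q)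
      (LinearMap.ker (inc e q).transpose.mulVecLin) := by
    ext φ
    rw [Submodule.mem_inf, mem_inv, mem_inv, Submodule.mem_map]
    constructor
    · rintro ⟨ha, hb⟩
      choose s hs using X.qsurj
      have hφ : ∀ d, φ (s (q d)) = φ d := by
        intro d
        rcases (X.qiff d (s (q d))).1 (hs _).symm with h | h | h | h <;> rw [h] <;> simp [ha]
      refine ⟨fun v => φ (s v), (hk _).2 fun d => ?_, ?_⟩
      · simp only [hφ, hb]
      · ext d
        exact hφ d
    · rintro ⟨f, hf, rfl⟩
      refine ⟨fun d => ?_, fun d => ?_⟩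
      · simp only [LinearMap.funLeft_apply, X.qr]
      · simp only [LinearMap.funLeft_apply]; exact (hk f).1 hf d
  rw [hE]

theorem dim_lemma [Fintype D] [Fintype V] [DecidableEq V] (X : XD e r q) {ρ : D → D}
    (hρ : ∀ d, (∀ y, q y = q d → ρ y = r y) ∨ (∀ y, q y = q d → ρ y = r (r (r y)))) :
    (Fintype.card V + finrank (ZMod 2) (inv (fun x => ρ (e x))) =
      finrank (ZMod 2) (inv e) + 2 * finrank (ZMod 2) (inv r ⊓ inv e : Submodule (ZMod 2) _)) ↔
    ∀ ψ, InZ e r ψ → ∃ φ : D → ZMod 2, (∀ x, φ (ρ x) = φ (e x)) ∧ ∀ x, φ x + φ (e x) = ψ x := by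
  have hF := finrank_map (dl e) (inv (fun x => ρ (e x)))
  have hZ := finrank_map (bd q) (inv e)
  have hB := finrank_bd X
  have hK : inv (fun x => ρ (e x)) ⊓ LinearMap.ker (dl e) = inv r ⊓ inv e := by
    rw [ker_dl]
    ext φ
    simp only [Submodule.mem_inf, mem_inv]
    refine and_congr_left fun h => ?_
    constructor
    · intro h1 x
      have h2 : ∀ y, φ (ρ y) = φ y := by
        intro y
        have := h1 (e y)
        rwa [X.ee, h] at this
      rcases hρ x with h3 | h3
      · rw [← h3 x rfl, h2]
      · have := h2 (r x)
        rw [h3 _ (X.qr x), X.r4] at this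
        exact this.symm
    · intro h1 x
      rcases hρ (e x) with h3 | h3
      · rw [h3 _ rfl, h1, h]
      · rw [h3 _ rfl, h1, h1, h1, h]
  have hle : (inv (fun x => ρ (e x))).map (dl e) ≤ inv e ⊓ LinearMap.ker (bd q) := by
    rintro _ ⟨φ, hφ, rfl⟩
    rw [mem_Z X]
    have h2 : ∀ y, φ (ρ y) = φ (e y) := by
      intro y
      have := hφ (e y)
      simp only [X.ee] at this
      exact this
    refine ⟨fun x => ?_, fun x => ?_⟩
    · simp only [dl_apply, X.ee]; rw [add_comm]
    · simp only [dl_apply, ← h2]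
      rcases hρ x with h3 | h3
      · rw [h3 x rfl, h3 _ (X.qr x), h3 _ (by rw [X.qr, X.qr]), h3 _ (by rw [X.qr, X.qr, X.qr]), X.r4]
        linear_combination z2_self (φ x) + z2_self (φ (r x)) + z2_self (φ (r (r x)))
          + z2_self (φ (r (r (r x))))
      · rw [h3 x rfl, h3 _ (X.qr x), h3 _ (by rw [X.qr, X.qr]), h3 _ (by rw [X.qr, X.qr, X.qr]),
          X.r4]
        linear_combination z2_self (φ x) + z2_self (φ (r x)) + z2_self (φ (r (r x)))
          + z2_self (φ (r (r (r x))))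
  rw [hK] at hF
  have hiff : (∀ ψ, InZ e r ψ → ∃ φ : D → ZMod 2, (∀ x, φ (ρ x) = φ (e x)) ∧
      ∀ x, φ x + φ (e x) = ψ x) ↔
      inv e ⊓ LinearMap.ker (bd q) ≤ (inv (fun x => ρ (e x))).map (dl e) := by
    constructor
    · intro h ψ hψ
      obtain ⟨φ, h1, h2⟩ := h ψ ((mem_Z X ψ).1 hψ)
      refine ⟨φ, fun x => ?_, ?_⟩
      · show φ (ρ (e x)) = φ x
        rw [h1, X.ee]
      · ext x; exact h2 x
    · intro h ψ hψ
      obtain ⟨φ, h1, h2⟩ := h ((mem_Z X ψ).2 hψ)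
      refine ⟨φ, fun x => ?_, fun x => ?_⟩
      · have := h1 (e x)
        simp only [X.ee] at this
        exact this
      · rw [← h2]; rfl
  rw [hiff]
  constructor
  · intro h
    exact (Submodule.eq_of_le_of_finrank_eq hle (by omega)).ge
  · intro h
    have := le_antisymm hle h
    rw [this] at hF
    omega

end

end XG


namespace XG
open Module

/-- the vertex map of a star graph -/
def vq (G : StarGraph) (d : G.D) : Quotient (Equiv.Perm.SameCycle.setoid G.rot) :=
  Quotient.mk _ d

theorem vq_iff (G : StarGraph) (a b : G.D) : vq G a = vq G b ↔ G.SameVertex a b := Quotient.eq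

theorem sameCycle_inv {D : Type} (f : Equiv.Perm D) (φ : D → ZMod 2) :
    φ ∈ inv (fun x => f x) ↔ ∀ a b, (Equiv.Perm.SameCycle.setoid f) a b → φ a = φ b := by
  rw [mem_inv]
  constructor
  · rintro h a b ⟨n, hn⟩
    rw [← hn]
    have key : ∀ n : ℕ, ∀ a, φ ((f ^ n) a) = φ a := by
      intro n
      induction n with
      | zero => intro a; rfl
      | succ k ih => intro a; rw [pow_succ, Equiv.Perm.mul_apply, ih, h]
    cases n with
    | ofNat n => exact (key n a).symm
    | negSucc n =>
      have := key (n + 1) ((f ^ (Int.negSucc n)) a)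
      rw [← this, zpow_negSucc, ← Equiv.Perm.mul_apply, mul_inv_cancel, Equiv.Perm.one_apply]
  · intro h x
    exact (h x (f x) ⟨1, by simp⟩).symm

theorem euler_iff (G : StarGraph) (hreg : ∀ d : G.D, G.degree d = 4) (ρ : Equiv.Perm G.D)
    (hρ : G.IsCompatibleRotation ρ) :
    ((G.numVertices : ℤ) - G.numEdges + G.numFaces ρ = 2 * G.numComponents) ↔
    ∀ ψ, InZ (fun d => G.edgeInv d) (fun d => G.rot d) ψ → ∃ φ : G.D → ZMod 2,
      (∀ x, φ (ρ x) = φ (G.edgeInv x)) ∧ ∀ x, φ x + φ (G.edgeInv x) = ψ x := by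
  classical
  have X : XD (fun d => G.edgeInv d) (fun d => G.rot d) (vq G) := xd_of_reg G hreg
  have : Fintype (Quotient (Equiv.Perm.SameCycle.setoid G.rot)) := Fintype.ofFinite _
  have hinv : ∀ y, G.rot⁻¹ y = G.rot (G.rot (G.rot y)) := by
    intro y
    rw [Equiv.Perm.inv_eq_iff_eq]
    exact (X.r4 y).symm
  have hd := dim_lemma X (ρ := fun d => ρ d) (by
    intro d
    rcases hρ d with h | h
    · exact Or.inl fun y hy => h y ((vq_iff G _ _).1 hy.symm)
    · exact Or.inr fun y hy => (h y ((vq_iff G _ _).1 hy.symm)).trans (hinv y))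
  rw [← hd]
  have h1 : G.numVertices = Fintype.card (Quotient (Equiv.Perm.SameCycle.setoid G.rot)) :=
    Nat.card_eq_fintype_card
  have h2 : G.numFaces ρ = finrank (ZMod 2) (inv (fun x => ρ (G.edgeInv x))) :=
    (finrank_setoid _ _ (sameCycle_inv (ρ * G.edgeInv))).symm
  have h3 : G.numEdges = finrank (ZMod 2) (inv (fun x => G.edgeInv x)) := by
    have : Fintype.card G.D = 2 * finrank (ZMod 2) (inv (fun x => G.edgeInv x)) :=
      edges_dim X.ee X.ene
    unfold StarGraph.numEdges
    omega
  have h4 : G.numComponents = finrank (ZMod 2)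
      (inv (fun x => G.rot x) ⊓ inv (fun x => G.edgeInv x) : Submodule (ZMod 2) _) := by
    refine (finrank_setoid _ _ fun φ => ?_).symm
    rw [Submodule.mem_inf, mem_inv, mem_inv]
    constructor
    · rintro ⟨ha, hb⟩ a b hab
      change Relation.EqvGen _ a b at hab
      induction hab with
      | rel x y h =>
        rcases h with h | h
        · rw [h, ha]
        · rw [h, hb]
      | refl x => rfl
      | symm x y _ ih => exact ih.symm
      | trans x y z _ _ ih1 ih2 => exact ih1.trans ih2
    · intro h
      exact ⟨fun x => (h x _ (Relation.EqvGen.rel _ _ (Or.inl rfl))).symm,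
        fun x => (h x _ (Relation.EqvGen.rel _ _ (Or.inr rfl))).symm⟩
  rw [h1, h2, h3, h4]
  constructor
  · intro h; omega
  · intro h; omega

/-- transition at a vertex determined by a cycle-space element -/
def sg {D : Type} (r : D → D) (ψ : D → ZMod 2) (d : D) : D :=
  if ψ (r (r d)) = ψ d then r (r d) else if ψ (r d) = ψ d then r d else r (r (r d))

section
variable {D V : Type} {e r : D → D} {q : D → V}

theorem sg_eq {ψ : D → ZMod 2} (h : InZ e r ψ) (d : D) : ψ (sg r ψ d) = ψ d := by
  have h1 := h.2 d
  unfold sg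
  split_ifs with h2 h3
  · exact h2
  · exact h3
  · revert h1 h2 h3
    generalize ψ d = a; generalize ψ (r d) = b; generalize ψ (r (r d)) = c
    generalize ψ (r (r (r d))) = f
    revert a b c f; decide

theorem sg_q (X : XD e r q) {ψ : D → ZMod 2} (d : D) : q (sg r ψ d) = q d := by
  unfold sg
  split_ifs <;> simp [X.qr]

theorem sg_ne (X : XD e r q) {ψ : D → ZMod 2} (d : D) : sg r ψ d ≠ d := by
  unfold sg
  split_ifs
  · exact X.r2 d
  · exact X.r1 d
  · exact X.r3 d

theorem sg_sg (X : XD e r q) {ψ : D → ZMod 2} (h : InZ e r ψ) (d : D) :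
    sg r ψ (sg r ψ d) = d := by
  have h1 := h.2 d
  by_cases h2 : ψ (r (r d)) = ψ d
  · have : sg r ψ d = r (r d) := by simp [sg, h2]
    rw [this]
    simp [sg, X.r4, h2]
  · by_cases h3 : ψ (r d) = ψ d
    · have : sg r ψ d = r d := by simp [sg, h2, h3]
      rw [this]
      have h4 : ψ (r (r (r d))) ≠ ψ (r d) := by
        revert h1 h2 h3
        generalize ψ d = a; generalize ψ (r d) = b; generalize ψ (r (r d)) = c
        generalize ψ (r (r (r d))) = f
        revert a b c f; decide
      have h5 : ψ (r (r d)) ≠ ψ (r d) := by rw [h3]; exact h2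
      simp [sg, h4, h5, X.r4]
    · have : sg r ψ d = r (r (r d)) := by simp [sg, h2, h3]
      rw [this]
      have h4 : ψ (r d) ≠ ψ (r (r (r d))) ∧ ψ d = ψ (r (r (r d))) := by
        revert h1 h2 h3
        generalize ψ d = a; generalize ψ (r d) = b; generalize ψ (r (r d)) = c
        generalize ψ (r (r (r d))) = f
        revert a b c f; decide
      simp [sg, h4.1, h4.2, X.r4]

end

/-- the trail of a free involution preserving vertices -/
theorem exists_trail (G : StarGraph) {σ : G.D → G.D} (ss : ∀ d, σ (σ d) = d) (sne : ∀ d, σ d ≠ d)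
    (sv : ∀ d, G.SameVertex d (σ d)) (d0 : G.D) :
    ∃ A : ClosedTrail G, A.dart 0 = d0 ∧ (∀ i, A.dart (i + 1) = σ (G.edgeInv (A.dart i))) ∧
      (∀ i, ∃ n : ℕ, A.dart i = (fun d => σ (G.edgeInv d))^[n] d0) ∧ ∀ i, A.dart i ≠ σ d0 := by
  set f : G.D → G.D := fun d => σ (G.edgeInv d) with hf
  have sinj : Function.Injective σ := Function.LeftInverse.injective ss
  have finj : Function.Injective f := sinj.comp G.edgeInv.injective
  have hp : 0 < Function.minimalPeriod f d0 :=
      Function.minimalPeriod_pos_of_mem_periodicPts (Function.Injective.mem_periodicPts finj d0)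
  have : NeZero (Function.minimalPeriod f d0) := ⟨hp.ne'⟩
  have hstep : ∀ i : ZMod (Function.minimalPeriod f d0),
      f^[(i + 1).val] d0 = f (f^[i.val] d0) := by
    intro i
    have h1 : (i + 1).val = (i.val + 1) % Function.minimalPeriod f d0 := by
      rw [ZMod.val_add, ZMod.val_one_eq_one_mod]; simp
    rw [h1, Function.iterate_mod_minimalPeriod_eq, Function.iterate_succ_apply']
  refine ⟨⟨Function.minimalPeriod f d0, hp, fun i => f^[i.val] d0, ?_, ?_⟩, ?_, ?_, ?_, ?_⟩
  · intro i
    simp only [hstep]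
    exact sv _
  · rintro i j (h | h)
    · have := (Function.iterate_eq_iterate_iff_of_lt_minimalPeriod (ZMod.val_lt i) (ZMod.val_lt j)).1 h
      exact ZMod.val_injective _ this
    · exfalso
      -- reach the reverse dart by going around the trail
      have h2 : f^[Function.minimalPeriod f d0 - j.val + i.val] (f^[j.val] d0) =
          G.edgeInv (f^[j.val] d0) := by
        rw [← Function.iterate_add_apply]
        have : Function.minimalPeriod f d0 - j.val + i.val + j.val =
            i.val + Function.minimalPeriod f d0 := by
          have := ZMod.val_lt j
          omega
        rw [this, Function.iterate_add_apply, Function.iterate_minimalPeriod]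
        exact h
      exact dihedral G.edgeInv_invol G.edgeInv_ne ss sne _ _ h2
  · simp
  · intro i; exact hstep i
  · intro i; exact ⟨i.val, rfl⟩
  · intro i h
    change f^[i.val] d0 = σ d0 at h
    cases hn : i.val with
    | zero => rw [hn] at h; exact sne d0 h.symm
    | succ k =>
      rw [hn, Function.iterate_succ_apply'] at h
      have h1 := sinj h
      have h2 : f^[k] d0 = G.edgeInv d0 := by
        have h3 := congrArg G.edgeInv h1
        rwa [G.edgeInv_invol] at h3
      exact dihedral G.edgeInv_invol G.edgeInv_ne ss sne _ _ h2

end XG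


namespace XG

theorem pair_of_obs (G : StarGraph) (hreg : ∀ d : G.D, G.degree d = 4)
    (ho : Obs (fun d => G.edgeInv d) (fun d => G.rot d) (vq G)) :
    ∃ A B : ClosedTrail G, A.EdgeDisjoint B ∧
          Nat.card {p : ZMod A.len × ZMod B.len // A.IsCrossingVertex B p} = 1 := by
  have X : XD (fun d => G.edgeInv d) (fun d => G.rot d) (vq G) := xd_of_reg G hreg
  obtain ⟨α, β, hα, hβ, hdis, d, ⟨p1, p2, p3, p4⟩, huniq⟩ := ho
  have key : ∀ (ψ : G.D → ZMod 2) (_ : InZ (fun d => G.edgeInv d) (fun d => G.rot d) ψ) (d0 : G.D),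
      ψ d0 = 1 → ψ (G.rot (G.rot d0)) = 1 → ∃ A : ClosedTrail G, A.dart 0 = d0 ∧
      (∀ i, ψ (A.dart i) = 1) ∧ (∀ i, A.dart i ≠ G.rot (G.rot d0)) ∧
      G.edgeInv (A.dart (0 - 1)) = G.rot (G.rot d0) := by
    intro ψ hψ d0 h0 h2
    obtain ⟨A, a0, a1, a2, a3⟩ := exists_trail G (σ := sg (fun d => G.rot d) ψ)
      (sg_sg X hψ) (sg_ne X) (fun d => (vq_iff G _ _).1 (sg_q X d).symm) d0
    have hs : sg (fun d => G.rot d) ψ d0 = G.rot (G.rot d0) := by simp [sg, h0, h2]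
    refine ⟨A, a0, ?_, ?_, ?_⟩
    · intro i
      obtain ⟨n, hn⟩ := a2 i
      rw [hn]
      clear hn
      induction n with
      | zero => exact h0
      | succ k ih =>
        rw [Function.iterate_succ_apply']
        show ψ (sg (fun d => G.rot d) ψ (G.edgeInv _)) = 1
        rw [sg_eq hψ]
        exact (hψ.1 _).trans ih
    · intro i; rw [← hs]; exact a3 i
    · have := a1 (0 - 1)
      rw [sub_add_cancel, a0] at this
      rw [← hs, this, sg_sg X hψ]
  obtain ⟨A, a0, a1, a2, a3⟩ := key α hα d p1 p2
  obtain ⟨B, b0, b1, b2, b3⟩ := key β hβ (G.rot d) p3 p4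
  refine ⟨A, B, ?_, ?_⟩
  · intro i j
    constructor
    · intro h
      exact hdis _ ⟨a1 i, by rw [h]; exact b1 j⟩
    · intro h
      exact hdis _ ⟨a1 i, by rw [h]; exact (hβ.1 _).trans (b1 j)⟩
  · rw [Nat.card_eq_one_iff_exists]
    refine ⟨⟨(0, 0), ?_⟩, ?_⟩
    · refine ⟨?_, ?_, ?_⟩
      · show G.SameVertex (A.dart 0) (B.dart 0)
        rw [a0, b0, ← vq_iff]
        exact (X.qr d).symm
      · show G.rot (G.rot (G.edgeInv (A.dart (0 - 1)))) = A.dart 0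
        rw [a3, a0]
        exact X.r4 d
      · show G.rot (G.rot (G.edgeInv (B.dart (0 - 1)))) = B.dart 0
        rw [b3, b0]
        exact X.r4 (G.rot d)
    · rintro ⟨⟨i, j⟩, h1, h2, h3⟩
      have hA : α (G.rot (G.rot (A.dart i))) = 1 := by
        have : G.rot (G.rot (A.dart i)) = G.edgeInv (A.dart (i - 1)) := by
          rw [← show G.rot (G.rot (G.edgeInv (A.dart (i - 1)))) = A.dart i from h2]
          exact X.r4 _
        rw [this]
        exact (hα.1 _).trans (a1 _)
      have hB : β (G.rot (G.rot (B.dart j))) = 1 := by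
        have : G.rot (G.rot (B.dart j)) = G.edgeInv (B.dart (j - 1)) := by
          rw [← show G.rot (G.rot (G.edgeInv (B.dart (j - 1)))) = B.dart j from h3]
          exact X.r4 _
        rw [this]
        exact (hβ.1 _).trans (b1 _)
      have hv : vq G (A.dart i) = vq G (B.dart j) := (vq_iff G _ _).2 h1
      have hai := a1 i
      have hbj := b1 j
      have hai2 := a2 i
      have hbj2 := b2 j
      have hi : A.dart i = d → i = 0 := fun h => A.edges_injective _ _ (Or.inl (h.trans a0.symm))
      have hj : B.dart j = G.rot d → j = 0 :=
        fun h => B.edges_injective _ _ (Or.inl (h.trans b0.symm))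
      suffices hij : i = 0 ∧ j = 0 from Subtype.ext (Prod.ext hij.1 hij.2)
      clear h1 h2 h3
      generalize A.dart i = y at *
      generalize B.dart j = w at *
      have hP : Pat (fun d => G.rot d) α β y := by
        rcases (X.qiff y w).1 hv with h | h | h | h
        · exact absurd ⟨hai, (by rw [h] at hbj; exact hbj)⟩ (hdis y)
        · exact ⟨hai, hA, (by rw [h] at hbj; exact hbj), by rw [h] at hB; exact hB⟩
        · exact absurd ⟨hA, (by rw [h] at hbj; exact hbj)⟩ (hdis _)
        · refine ⟨hai, hA, ?_, (by rw [h] at hbj; exact hbj)⟩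
          rw [h, X.r4 (G.rot y)] at hB
          exact hB
      have hd := huniq y hP
      have hyd : y = d := by
        rcases (X.qiff d y).1 hd.symm with h | h | h | h
        · exact h
        · exact absurd ⟨(by rw [h] at hai; exact hai), p3⟩ (hdis _)
        · exact absurd h hai2
        · exact absurd ⟨(by rw [h] at hai; exact hai), p4⟩ (hdis _)
      have hwd : w = G.rot d := by
        rcases (X.qiff d w).1 (hd.symm.trans hv) with h | h | h | h
        · exact absurd ⟨p1, (by rw [h] at hbj; exact hbj)⟩ (hdis _)
        · exact h
        · exact absurd ⟨p2, (by rw [h] at hbj; exact hbj)⟩ (hdis _)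
        · exact absurd h hbj2
      exact ⟨hi hyd, hj hwd⟩

theorem planar_of_no_obs (G : StarGraph) (hreg : ∀ d : G.D, G.degree d = 4)
    (ho : ¬ Obs (fun d => G.edgeInv d) (fun d => G.rot d) (vq G)) : G.StarPlanar := by
  classical
  have X : XD (fun d => G.edgeInv d) (fun d => G.rot d) (vq G) := xd_of_reg G hreg
  have : Fintype (Quotient (Equiv.Perm.SameCycle.setoid G.rot)) := Fintype.ofFinite _
  obtain ⟨ρ, hρ, hφ⟩ := exists_rho X ho
  have hq : ∀ d, vq G (ρ d) = vq G d := by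
    intro d
    rcases hρ d with h | h
    · rw [h d rfl]; exact X.qr d
    · rw [h d rfl]; exact (X.qr _).trans ((X.qr _).trans (X.qr _))
  have hinj : Function.Injective ρ := by
    intro a b hab
    have h1 : vq G a = vq G b := by rw [← hq a, hab, hq]
    rcases hρ a with h | h
    · rw [h a rfl, h b h1.symm] at hab
      exact X.rinj hab
    · rw [h a rfl, h b h1.symm] at hab
      exact X.rinj (X.rinj (X.rinj hab))
  have hinv : ∀ y, G.rot⁻¹ y = G.rot (G.rot (G.rot y)) := by
    intro y
    rw [Equiv.Perm.inv_eq_iff_eq]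
    exact (X.r4 y).symm
  let P : Equiv.Perm G.D := Equiv.ofBijective ρ (Finite.injective_iff_bijective.1 hinj)
  have hP : G.IsCompatibleRotation P := by
    intro d
    rcases hρ d with h | h
    · exact Or.inl fun y hy => h y ((vq_iff G _ _).2 hy).symm
    · exact Or.inr fun y hy => (h y ((vq_iff G _ _).2 hy).symm).trans (hinv y).symm
  exact ⟨P, hP, (euler_iff G hreg P hP).2 hφ⟩

end XG


namespace XG

/-- mod 2 indicator of the darts of a closed trail -/
noncomputable def ind {G : StarGraph} (A : ClosedTrail G) [NeZero A.len] (d : G.D) : ZMod 2 :=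
  ∑ i : ZMod A.len, ((if d = A.dart i then 1 else 0) + (if d = G.edgeInv (A.dart i) then 1 else 0))

section
variable {G : StarGraph} (A : ClosedTrail G) [NeZero A.len]

theorem ind_e (d : G.D) : ind A (G.edgeInv d) = ind A d := by
  unfold ind
  refine Finset.sum_congr rfl fun i _ => ?_
  have h1 : (G.edgeInv d = A.dart i) ↔ d = G.edgeInv (A.dart i) := by
    constructor
    · intro h; rw [← h, G.edgeInv_invol]
    · intro h; rw [h, G.edgeInv_invol]
  have h2 : (G.edgeInv d = G.edgeInv (A.dart i)) ↔ d = A.dart i := G.edgeInv.injective.eq_iff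
  simp only [h1, h2]
  rw [add_comm]

theorem ind_dart (i : ZMod A.len) : ind A (A.dart i) = 1 := by
  unfold ind
  rw [Finset.sum_eq_single i]
  · rw [if_pos rfl, if_neg (fun h => G.edgeInv_ne _ h.symm), add_zero]
  · intro k _ hk
    rw [if_neg, if_neg, add_zero]
    · intro h; exact hk (A.edges_injective _ _ (Or.inr h)).symm
    · intro h; exact hk (A.edges_injective _ _ (Or.inl h)).symm
  · intro h; exact absurd (Finset.mem_univ i) h

theorem ind_zero (d : G.D) (h : ∀ i, d ≠ A.dart i ∧ d ≠ G.edgeInv (A.dart i)) : ind A d = 0 := by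
  unfold ind
  refine Finset.sum_eq_zero fun i _ => ?_
  rw [if_neg (h i).1, if_neg (h i).2, add_zero]

theorem ind_one (d : G.D) (h : ind A d = 1) : ∃ i, d = A.dart i ∨ d = G.edgeInv (A.dart i) := by
  by_contra hc
  push Not at hc
  rw [ind_zero A d hc] at h
  exact zero_ne_one h

theorem noback (i : ZMod A.len) : A.dart i ≠ G.edgeInv (A.dart (i - 1)) := by
  intro h
  have := A.edges_injective _ _ (Or.inr h)
  rw [← this] at h
  exact G.edgeInv_ne _ h.symm

theorem ind_InZ (X : XD (fun d => G.edgeInv d) (fun d => G.rot d) (vq G)) :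
    InZ (fun d => G.edgeInv d) (fun d => G.rot d) (ind A) := by
  classical
  refine ⟨fun d => ind_e A d, fun d => ?_⟩
  rw [← sum_fiber X]
  have h1 : (∑ y, if vq G y = vq G d then ind A y else 0) =
      ∑ i : ZMod A.len, ((if vq G (A.dart i) = vq G d then 1 else 0) +
        (if vq G (G.edgeInv (A.dart i)) = vq G d then 1 else 0)) := by
    have : ∀ y, (if vq G y = vq G d then ind A y else 0) = ∑ i : ZMod A.len,
        ((if y = A.dart i then (if vq G (A.dart i) = vq G d then 1 else 0) else 0) +
        (if y = G.edgeInv (A.dart i) then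
          (if vq G (G.edgeInv (A.dart i)) = vq G d then 1 else 0) else 0)) := by
      intro y
      unfold ind
      split_ifs with h
      · refine Finset.sum_congr rfl fun i _ => ?_
        congr 1
        · by_cases h1 : y = A.dart i
          · rw [if_pos h1, if_pos h1, ← h1, if_pos h]
          · rw [if_neg h1, if_neg h1]
        · by_cases h1 : y = G.edgeInv (A.dart i)
          · rw [if_pos h1, if_pos h1, ← h1, if_pos h]
          · rw [if_neg h1, if_neg h1]
      · symm
        refine Finset.sum_eq_zero fun i _ => ?_
        have ha : (if y = A.dart i then (if vq G (A.dart i) = vq G d then (1 : ZMod 2) else 0)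
            else 0) = 0 := by
          by_cases h1 : y = A.dart i
          · rw [if_pos h1, ← h1, if_neg h]
          · rw [if_neg h1]
        have hb : (if y = G.edgeInv (A.dart i) then
            (if vq G (G.edgeInv (A.dart i)) = vq G d then (1 : ZMod 2) else 0) else 0) = 0 := by
          by_cases h1 : y = G.edgeInv (A.dart i)
          · rw [if_pos h1, ← h1, if_neg h]
          · rw [if_neg h1]
        rw [ha, hb, add_zero]
    rw [Finset.sum_congr rfl fun y _ => this y, Finset.sum_comm]
    refine Finset.sum_congr rfl fun i _ => ?_
    rw [Finset.sum_add_distrib, Finset.sum_ite_eq' , Finset.sum_ite_eq']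
    simp
  rw [h1, Finset.sum_add_distrib]
  have h2 : (∑ i : ZMod A.len, if vq G (G.edgeInv (A.dart i)) = vq G d then (1 : ZMod 2) else 0) =
      ∑ i : ZMod A.len, if vq G (A.dart i) = vq G d then (1 : ZMod 2) else 0 := by
    refine Fintype.sum_equiv (Equiv.addRight (1 : ZMod A.len)) _ _ fun i => ?_
    rw [(vq_iff G _ _).2 (A.next_sameVertex i)]
    rfl
  rw [h2]
  exact z2_self _

theorem prev_vq (i : ZMod A.len) : vq G (G.edgeInv (A.dart (i - 1))) = vq G (A.dart i) := by
  have := A.next_sameVertex (i - 1)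
  rw [sub_add_cancel] at this
  exact (vq_iff G _ _).2 this

end

theorem no_pair (G : StarGraph) (hreg : ∀ d : G.D, G.degree d = 4) (hpl : G.StarPlanar)
    (A B : ClosedTrail G) (hdis : A.EdgeDisjoint B)
    (hc : Nat.card {p : ZMod A.len × ZMod B.len // A.IsCrossingVertex B p} = 1) : False := by
  classical
  have X : XD (fun d => G.edgeInv d) (fun d => G.rot d) (vq G) := xd_of_reg G hreg
  have r4 : ∀ d, G.rot (G.rot (G.rot (G.rot d))) = d := X.r4
  have qr : ∀ d, vq G (G.rot d) = vq G d := X.qr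
  have qiff : ∀ x y, vq G x = vq G y ↔ (y = x ∨ y = G.rot x ∨ y = G.rot (G.rot x) ∨
    y = G.rot (G.rot (G.rot x))) := X.qiff
  have hinv : ∀ y, G.rot⁻¹ y = G.rot (G.rot (G.rot y)) := by
    intro y
    rw [Equiv.Perm.inv_eq_iff_eq]
    exact (X.r4 y).symm
  have : NeZero A.len := ⟨A.len_pos.ne'⟩
  have : NeZero B.len := ⟨B.len_pos.ne'⟩
  obtain ⟨ρ, hρ, hE⟩ := hpl
  obtain ⟨φ, f1, f2⟩ := (euler_iff G hreg ρ hρ).1 hE (ind A) (ind_InZ A X)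
  have hstep : ∀ x, φ (ρ x) = φ x + ind A x := by
    intro x
    rw [f1, ← f2, ← add_assoc, z2_self, zero_add]
  have hB : ∀ j, ind A (B.dart j) = 0 := by
    intro j
    refine ind_zero A _ fun i => ⟨(hdis i j).1.symm, fun h => (hdis i j).2 ?_⟩
    rw [h, G.edgeInv_invol]
  -- the transport across one vertex of `B`
  have hcr : ∀ j, (∃ i, A.IsCrossingVertex B (i, j)) ↔
      (B.dart j = G.rot (G.rot (G.edgeInv (B.dart (j - 1)))) ∧
        ind A (G.rot (G.edgeInv (B.dart (j - 1)))) = 1) := by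
    intro j
    have hb' := hB j
    have hb : ind A (G.edgeInv (B.dart (j - 1))) = 0 := by rw [ind_e]; exact hB _
    have hv := prev_vq B j
    have hx : ∀ i, A.IsCrossingVertex B (i, j) ↔ vq G (A.dart i) = vq G (B.dart j) ∧
        G.rot (G.rot (G.edgeInv (A.dart (i - 1)))) = A.dart i ∧
        G.rot (G.rot (G.edgeInv (B.dart (j - 1)))) = B.dart j := by
      intro i
      rw [vq_iff]
      exact Iff.rfl
    simp only [hx]
    generalize G.edgeInv (B.dart (j - 1)) = b at *
    generalize B.dart j = b' at *
    constructor
    · rintro ⟨i, h1, h2, h3⟩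
      refine ⟨h3.symm, ?_⟩
      have hi := ind_dart A i
      have hi' : ind A (G.edgeInv (A.dart (i - 1))) = 1 := by rw [ind_e]; exact ind_dart A _
      rcases (qiff b _).1 (hv.trans h1.symm) with h | h | h | h
      · rw [h, hb] at hi; exact absurd hi zero_ne_one
      · rw [← h]; exact hi
      · rw [h, h3, hb'] at hi; exact absurd hi zero_ne_one
      · rw [h] at h2
        have := G.rot.injective (G.rot.injective h2)
        rw [← this]; exact hi'
    · rintro ⟨h1, h2⟩
      obtain ⟨i, h | h⟩ := ind_one A _ h2
      · have hi' : ind A (G.edgeInv (A.dart (i - 1))) = 1 := by rw [ind_e]; exact ind_dart A _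
        have hq := prev_vq A i
        have hq2 : vq G (A.dart i) = vq G b := by rw [← h, qr]
        refine ⟨i, by rw [← h, qr, hv], ?_, h1.symm⟩
        rcases (qiff b _).1 (hq.trans hq2).symm with h' | h' | h' | h'
        · rw [h', hb] at hi'; exact absurd hi' zero_ne_one
        · exact absurd (h.symm.trans h'.symm) (noback A i)
        · rw [h', ← h1, hb'] at hi'; exact absurd hi' zero_ne_one
        · rw [h', r4 (G.rot b), h]
      · have hi' := ind_dart A (i + 1)
        have hq := prev_vq A (i + 1)
        have hnb := noback A (i + 1)
        rw [add_sub_cancel_right] at hq hnb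
        have hq2 : vq G b = vq G (A.dart (i + 1)) := by rw [← hq, ← h, qr]
        refine ⟨i + 1, by rw [← hq2, hv], ?_, h1.symm⟩
        rw [add_sub_cancel_right]
        rcases (qiff b _).1 hq2 with h' | h' | h' | h'
        · rw [h', hb] at hi'; exact absurd hi' zero_ne_one
        · exact absurd (h'.trans h) hnb
        · rw [h', ← h1, hb'] at hi'; exact absurd hi' zero_ne_one
        · rw [h', h]
  have htr : ∀ j, φ (B.dart j) + φ (B.dart (j - 1)) =
      if ∃ i, A.IsCrossingVertex B (i, j) then 1 else 0 := by
    intro j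
    rw [if_congr (hcr j) rfl rfl]
    have hb' := hB j
    have hb : ind A (G.edgeInv (B.dart (j - 1))) = 0 := by rw [ind_e]; exact hB _
    have hv := prev_vq B j
    have hφ : φ (B.dart (j - 1)) = φ (G.edgeInv (B.dart (j - 1))) := by
      have := f2 (B.dart (j - 1))
      rw [hB] at this
      exact z2_eq this
    rw [hφ]
    generalize G.edgeInv (B.dart (j - 1)) = b at *
    generalize B.dart j = b' at *
    have hR : ∀ x, vq G b = vq G x → (φ x = φ b ∧ x ≠ G.rot (G.rot b) ∨ ind A x ≠ 0 ∨
        x = G.rot (G.rot b) ∧ φ x = φ b + ind A (G.rot b)) := by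
      intro x hx
      by_cases hx0 : ind A x = 0
      swap
      · exact Or.inr (Or.inl hx0)
      rcases hρ b with h | h
      · have hs : ∀ y, vq G b = vq G y → φ (G.rot y) = φ y + ind A y := by
          intro y hy
          rw [← h y ((vq_iff G _ _).1 hy), hstep]
        rcases (qiff b x).1 hx with h' | h' | h' | h'
        · left; rw [h']; exact ⟨rfl, (X.r2 b).symm⟩
        · left; rw [h', hs b rfl, hb, add_zero]
          exact ⟨rfl, fun hh => X.r1 b (G.rot.injective hh).symm⟩
        · right; right
          refine ⟨h', ?_⟩
          rw [h', hs _ (qr b).symm, hs b rfl, hb, add_zero]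
        · left
          have := hs x hx
          rw [hx0, add_zero, h', r4] at this
          rw [h']
          exact ⟨this.symm, fun hh => X.r1 b (G.rot.injective (G.rot.injective hh))⟩
      · have hs : ∀ y, vq G b = vq G y → φ y = φ (G.rot y) + ind A (G.rot y) := by
          intro y hy
          have h2 : vq G b = vq G (G.rot y) := by rw [qr, hy]
          rw [← hstep, h _ ((vq_iff G _ _).1 h2), hinv, r4]
        rcases (qiff b x).1 hx with h' | h' | h' | h'
        · left; rw [h']; exact ⟨rfl, (X.r2 b).symm⟩
        · left
          have := hs b rfl
          rw [← h', hx0, add_zero] at this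
          rw [← this, h']
          exact ⟨rfl, fun hh => X.r1 b (G.rot.injective hh).symm⟩
        · right; right
          refine ⟨h', ?_⟩
          have h3 := hs b rfl
          have h4 := hs (G.rot b) (qr b).symm
          rw [← h', hx0, add_zero] at h4
          rw [h3, ← h4, add_assoc, z2_self, add_zero]
        · left
          have := hs x hx
          rw [h', r4, hb, add_zero] at this
          rw [h']
          exact ⟨this, fun hh => X.r1 b (G.rot.injective (G.rot.injective hh))⟩
    rcases hR b' hv with ⟨h1, h2⟩ | h1 | ⟨h1, h2⟩
    · rw [h1, if_neg (fun h => h2 h.1)]; exact z2_self _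
    · exact absurd hb' h1
    · rw [h2, add_comm, ← add_assoc, z2_self, zero_add]
      rcases z2_cases (ind A (G.rot b)) with h | h
      · rw [if_neg, h]
        rintro ⟨-, hh⟩
        rw [h] at hh; exact zero_ne_one hh
      · rw [if_pos ⟨h1, h⟩, h]
  have hs1 : ∑ j, (φ (B.dart j) + φ (B.dart (j - 1))) = 0 := by
    rw [Finset.sum_add_distrib]
    have : ∑ j, φ (B.dart (j - 1)) = ∑ j, φ (B.dart j) :=
      Fintype.sum_equiv (Equiv.subRight (1 : ZMod B.len)) _ _ fun i => rfl
    rw [this]; exact z2_self _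
  obtain ⟨⟨⟨i0, j0⟩, h0⟩, hu⟩ := Nat.card_eq_one_iff_exists.1 hc
  have hs2 : ∑ j, (φ (B.dart j) + φ (B.dart (j - 1))) = 1 := by
    simp only [htr]
    rw [Finset.sum_eq_single j0]
    · rw [if_pos ⟨i0, h0⟩]
    · intro j _ hj
      rw [if_neg]
      rintro ⟨i, hi⟩
      exact hj (congrArg (fun p => p.1.2) (hu ⟨(i, j), hi⟩))
    · intro h; exact absurd (Finset.mem_univ _) h
  rw [hs1] at hs2
  exact zero_ne_one hs2

end XG

/-- Vassiliev's conjecture (Manturov's theorem): a 4-regular X-graph admits an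
X-embedding into the plane if and only if it does not contain two cycles
without common edges having exactly one crossing vertex. -/
theorem xPlanar_iff_no_crossing_pair (G : StarGraph)
    (hreg : ∀ d : G.D, G.degree d = 4) :
    G.StarPlanar ↔
      ¬ ∃ A B : ClosedTrail G, A.EdgeDisjoint B ∧
          Nat.card {p : ZMod A.len × ZMod B.len // A.IsCrossingVertex B p} = 1 := by
  constructor
  · rintro hpl ⟨A, B, h1, h2⟩
    exact XG.no_pair G hreg hpl A B h1 h2
  · intro h
    exact XG.planar_of_no_obs G hreg fun ho => h (XG.pair_of_obs G hreg ho)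
end

section
/- Let G be a *-graph in which every vertex has degree 4 or 6, and let G' be an expansion of G. If G' admits an X-embedding into the sphere, then G' admits an X-embedding into the sphere in which every expansion triangle bounds an empty region, i.e., one of the two regions of the sphere bounded by the embedded triangle contains no other point of the embedded graph. -/
/-!
**Expansions.**  Let `G` be a *-graph all of whose vertices are 4- or 6-valent.
An expansion `G'` of `G` is the 4-regular X-graph obtained by replacing every
6-valent vertex `v` of `G` by a triangle: if the *-structure at `v` is the
cyclic order `(A, B, C, D, E, F)`, then `v` is replaced by three new 4-valent
vertices `u₁, u₂, u₃` joined in a triangle, with `u₁` carrying the pendant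
half-edges `A, B`, `u₂` carrying `C, D` and `u₃` carrying `E, F`, the
*-structure at `u₁` being the cyclic order `(edge u₃u₁, A, B, edge u₁u₂)`,
i.e. `A` is opposite the edge `u₁u₂` and `B` is opposite the edge `u₃u₁`
(or the mirror arrangement; both triangle arrangements are allowed, at each
6-valent vertex independently).  Since all vertices of `G'` are 4-valent,
its X-structure is recorded by the opposition involution `rot²`.

In the data below, `leader` selects from each pair `{A, B}, {C, D}, {E, F}`
its first element (`leader_alt` says exactly that the chosen darts alternate
around each 6-valent vertex, so choosing a different starting dart of the
cyclic order realizes the other possible grouping into pairs), `ι` is the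
inclusion of the darts of `G` into the darts of `G'`, and `L x`, `R x` are
the two triangle darts at the new vertex carrying the pair `(x, rot x)` of a
leader `x`, with cyclic order `(L x, ι x, ι (rot x), R x)` at that vertex. -/
structure ExpansionData (G G' : StarGraph) : Type where
  /-- the inclusion of old darts into the expanded graph -/
  ι : G.D → G'.D
  /-- the chosen first elements of the pairs of consecutive darts at 6-valent
  vertices -/
  leader : G.D → Prop
  /-- `L x` is the triangle dart preceding `ι x` at the new vertex of a leader `x` -/
  L : G.D → G'.D
  /-- `R x` is the triangle dart following `ι (rot x)` at the new vertex of a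
  leader `x` -/
  R : G.D → G'.D
  ι_inj : Function.Injective ι
  /-- old edges are preserved -/
  map_edgeInv : ∀ d, G'.edgeInv (ι d) = ι (G.edgeInv d)
  /-- the expansion is 4-regular, i.e. an X-graph -/
  regular4 : ∀ d', G'.degree d' = 4
  /-- 4-valent vertices of `G` are kept, with their *-structure: same vertex … -/
  four_sameVertex : ∀ d, G.degree d = 4 → G'.SameVertex (ι d) (ι (G.rot d))
  /-- … and same opposition (which, at a 4-valent vertex, is equivalent to the
  *-structure) -/
  four_opp : ∀ d, G.degree d = 4 → (G'.rot ^ 2) (ι d) = ι ((G.rot ^ 2) d)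
  /-- around a 6-valent vertex, the leaders are exactly every other dart -/
  leader_alt : ∀ d, G.degree d = 6 → (leader d ↔ ¬ leader (G.rot d))
  /-- the pair `(x, rot x)` of a leader `x` stays together at one new vertex … -/
  six_sameVertex : ∀ x, G.degree x = 6 → leader x → G'.SameVertex (ι x) (ι (G.rot x))
  /-- … whose cyclic order is `(L x, ι x, ι (rot x), R x)`: `ι x` is opposite `R x` … -/
  six_oppR : ∀ x, G.degree x = 6 → leader x → (G'.rot ^ 2) (ι x) = R x
  /-- … and `ι (rot x)` is opposite `L x` -/
  six_oppL : ∀ x, G.degree x = 6 → leader x → (G'.rot ^ 2) (ι (G.rot x)) = L x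
  /-- the triangle edges join consecutive new vertices: at each 6-valent vertex,
  in one of the two possible arrangements, `R x` is glued to the `L`-dart of the
  next (resp. of the previous) leader -/
  triangle : ∀ d, G.degree d = 6 →
      (∀ x, G.SameVertex d x → leader x →
        G'.edgeInv (R x) = L ((G.rot ^ 2) x)) ∨
      (∀ x, G.SameVertex d x → leader x →
        G'.edgeInv (R x) = L ((G.rot ^ 4) x))
  /-- triangle darts are new -/
  new_not_old : ∀ x d, G.degree x = 6 → leader x → L x ≠ ι d ∧ R x ≠ ι d
  /-- every dart of `G'` is an old dart or a triangle dart -/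
  cover : ∀ d', (∃ d, ι d = d') ∨
      ∃ x, G.degree x = 6 ∧ leader x ∧ (L x = d' ∨ R x = d')

/-- `G'` is an expansion of the *-graph `G`. -/
def IsExpansion (G G' : StarGraph) : Prop := Nonempty (ExpansionData G G')

/-!
**Regions.**  Fix a rotation system `ρ` describing an embedding of a graph into
the sphere.  The faces of the embedding are the cycles of the face permutation
`ρ * edgeInv`.  Given a cycle `T` of the graph (recorded as the set of darts of
its edges, closed under `edgeInv`), the embedded cycle is a simple closed curve
and the complement of its image in the sphere splits into regions — the inside
and the outside of the curve, by the Jordan curve theorem.  A point of the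
complement of the curve lies in the region obtained by gluing the faces of the
embedding along all edges not belonging to `T`; accordingly, two darts (i.e.
the interiors of their half-edges, and the faces incident to them) lie in the
same region iff they are related by the equivalence generated by "lying on the
same face" together with "being the two sides of an edge not in `T`". -/

/-- The face permutation of the rotation system `ρ`. -/
def StarGraph.facePerm (G : StarGraph) (ρ : Equiv.Perm G.D) : Equiv.Perm G.D :=
  ρ * G.edgeInv

/-- The darts `a` and `b` lie in the same region of the complement of the
embedded cycle `T` in the sphere, for the embedding given by the rotation
system `ρ`. -/
def SameRegion (G : StarGraph) (ρ : Equiv.Perm G.D) (T : Set G.D) (a b : G.D) : Prop :=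
  Relation.EqvGen
    (fun d e => (G.facePerm ρ).SameCycle d e ∨ (d ∉ T ∧ e = G.edgeInv d)) a b

/-- The set of darts of the expansion triangle created for the 6-valent vertex
of `G` containing the dart `x`. -/
def ExpansionData.TriangleDarts {G G' : StarGraph} (E : ExpansionData G G')
    (x : G.D) : Set G'.D :=
  {d' | ∃ y, G.SameVertex x y ∧ E.leader y ∧ (d' = E.L y ∨ d' = E.R y)}

/-- The embedded cycle `T` (a set of darts closed under `edgeInv`) bounds an
empty region in the embedding given by the rotation system `ρ`: one of the two
regions of the sphere bounded by the embedded cycle contains no other point of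
the embedded graph, i.e. that region is a single face of the embedding whose
boundary walk consists of darts of `T`, traversing no edge twice. -/
def BoundsEmptyRegion (G : StarGraph) (ρ : Equiv.Perm G.D) (T : Set G.D) : Prop :=
  ∃ d ∈ T, ∀ e, (G.facePerm ρ).SameCycle d e →
    e ∈ T ∧ ¬ (G.facePerm ρ).SameCycle d (G.edgeInv e)

namespace XP
open Equiv
set_option linter.unusedSectionVars false
variable {D : Type} [Fintype D] [DecidableEq D]

noncomputable def nc (r : Setoid D) : ℕ := Nat.card (Quotient r)

theorem nc_mono {r s : Setoid D} (h : r ≤ s) : nc s ≤ nc r := by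
  classical
  unfold nc
  exact Nat.card_le_card_of_surjective (Quotient.map' id (fun a b hab => h hab)) (by
    intro q
    induction q using Quotient.inductionOn with
    | h a => exact ⟨⟦a⟧, rfl⟩)

open Classical in
noncomputable def joinFun (r : Setoid D) (x y : D) (a : D) : Quotient r :=
  if r a y then Quotient.mk r x else Quotient.mk r a

noncomputable def join (r : Setoid D) (x y : D) : Setoid D := Setoid.ker (joinFun r x y)

theorem le_join (r : Setoid D) (x y : D) : r ≤ join r x y := by
  classical
  intro a b hab
  change joinFun r x y a = joinFun r x y b
  unfold joinFun
  have : r a y ↔ r b y := ⟨fun h => r.trans (r.symm hab) h, fun h => r.trans hab h⟩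
  by_cases h : r a y
  · rw [if_pos h, if_pos (this.1 h)]
  · rw [if_neg h, if_neg (fun hb => h (this.2 hb))]
    exact Quotient.sound hab

theorem join_pair (r : Setoid D) (x y : D) : join r x y x y := by
  classical
  change joinFun r x y x = joinFun r x y y
  unfold joinFun
  rw [if_pos (r.refl y)]
  split_ifs <;> rfl

theorem join_le {r s : Setoid D} {x y : D} (h : r ≤ s) (hxy : s x y) : join r x y ≤ s := by
  classical
  intro a b hab
  change joinFun r x y a = joinFun r x y b at hab
  unfold joinFun at hab
  split_ifs at hab with h1 h2 h2
  · exact s.trans (h h1) (s.symm (h h2))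
  · exact s.trans (h h1) (s.trans (s.symm hxy) (h (Quotient.exact hab)))
  · exact s.trans (h (Quotient.exact hab)) (s.trans hxy (s.symm (h h2)))
  · exact h (Quotient.exact hab)

theorem nc_join {r : Setoid D} {x y : D} (h : ¬ r x y) : nc (join r x y) + 1 = nc r := by
  classical
  unfold nc join
  rw [Nat.card_congr (Setoid.quotientKerEquivRange (joinFun r x y))]
  have : Set.range (joinFun r x y) = {Quotient.mk r y}ᶜ := by
    ext q
    constructor
    · rintro ⟨a, rfl⟩
      unfold joinFun
      intro hq
      split_ifs at hq with h1
      · exact h (Quotient.exact hq)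
      · exact h1 (Quotient.exact hq)
    · intro hq
      induction q using Quotient.inductionOn with
      | h a =>
        refine ⟨a, ?_⟩
        unfold joinFun
        rw [if_neg]
        intro h1
        exact hq (Quotient.sound h1)
  rw [this]
  have h1 := Set.ncard_add_ncard_compl ({Quotient.mk r y} : Set (Quotient r))
  rw [Set.ncard_singleton] at h1
  rw [Nat.card_coe_set_eq]
  omega

noncomputable def cc (f : Perm D) : ℕ := nc (Perm.SameCycle.setoid f)

theorem sc_le {f : Perm D} {s : Setoid D} (h : ∀ d, s d (f d)) :
    Perm.SameCycle.setoid f ≤ s := by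
  intro a b hab
  change f.SameCycle a b at hab
  obtain ⟨n, rfl⟩ := hab.exists_nat_pow_eq
  clear hab
  induction n with
  | zero => exact s.refl _
  | succ n ih => rw [pow_succ']; exact s.trans ih (h _)

theorem iter_swap (f : Perm D) {x y : D} (n : ℕ)
    (h : ∀ k, 0 < k → k ≤ n → (f ^ k) y ≠ x ∧ (f ^ k) y ≠ y) :
    ((f * swap x y) ^ (n + 1)) x = (f ^ (n + 1)) y := by
  induction n with
  | zero => simp
  | succ n ih =>
    rw [pow_succ', Perm.mul_apply, ih (fun k hk hkn => h k hk (by omega)), pow_succ' f (n + 1),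
      Perm.mul_apply, Perm.mul_apply,
      swap_apply_of_ne_of_ne (h (n + 1) (by omega) le_rfl).1 (h (n + 1) (by omega) le_rfl).2]

theorem merge_same (f : Perm D) {x y : D} (h : ¬ f.SameCycle x y) :
    (f * swap x y).SameCycle x y := by
  classical
  have hex : ∃ n, (f ^ (n + 1)) y = y := by
    refine ⟨orderOf f - 1, ?_⟩
    rw [Nat.sub_add_cancel (orderOf_pos f), pow_orderOf_eq_one]; rfl
  have hs := Nat.find_spec hex
  refine ⟨(Nat.find hex + 1 : ℕ), ?_⟩
  rw [zpow_natCast, iter_swap, hs]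
  intro k hk hkn
  constructor
  · intro he
    exact h (Perm.SameCycle.symm ⟨k, by rw [zpow_natCast, he]⟩)
  · intro he
    have := Nat.find_min hex (m := k - 1) (by omega)
    rw [Nat.sub_add_cancel hk] at this
    exact this he

theorem split_not_same (f : Perm D) {x y : D} (hne : x ≠ y) (h : f.SameCycle x y) :
    ¬ (f * swap x y).SameCycle x y := by
  classical
  have hex : ∃ n, (f ^ (n + 1)) y = x := by
    obtain ⟨n, hn⟩ := h.symm.exists_nat_pow_eq
    cases n with
    | zero => exact absurd hn.symm hne
    | succ n => exact ⟨n, hn⟩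
  have hs := Nat.find_spec hex
  set n := Nat.find hex with hn
  have key : ∀ k, 0 < k → k ≤ n → (f ^ k) y ≠ x ∧ (f ^ k) y ≠ y := by
    intro k hk hkn
    constructor
    · intro he
      have := Nat.find_min hex (m := k - 1) (by omega)
      rw [Nat.sub_add_cancel hk] at this
      exact this he
    · intro he
      have := Nat.find_min hex (m := n - k) (by omega)
      apply this
      have h2 : n + 1 = (n - k + 1) + k := by omega
      rw [h2, pow_add, Perm.mul_apply, he] at hs
      exact hs
  have hper : ((f * swap x y) ^ (n + 1)) x = x := by rw [iter_swap f n key, hs]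
  have hsmall : ∀ m, m < n + 1 → ((f * swap x y) ^ m) x ≠ y := by
    intro m hm
    cases m with
    | zero => exact hne
    | succ m =>
      rw [iter_swap f m (fun k hk hkm => key k hk (by omega))]
      exact (key (m + 1) (by omega) (by omega)).2
  intro hsc
  obtain ⟨m, hm⟩ := hsc.exists_nat_pow_eq
  have hmul : ∀ j : ℕ, (((f * swap x y) ^ (n + 1)) ^ j) x = x := by
    intro j
    induction j with
    | zero => rfl
    | succ j ih => rw [pow_succ, Perm.mul_apply, hper, ih]
  rw [← Nat.mod_add_div m (n + 1), pow_add, Perm.mul_apply, pow_mul, hmul] at hm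
  exact hsmall _ (Nat.mod_lt _ (by omega)) hm

theorem cc_merge (f : Perm D) {x y : D} (h : ¬ f.SameCycle x y) :
    cc (f * swap x y) + 1 = cc f := by
  have : Perm.SameCycle.setoid (f * swap x y) = join (Perm.SameCycle.setoid f) x y := by
    apply le_antisymm
    · apply sc_le
      intro d
      have hstep : ∀ e, join (Perm.SameCycle.setoid f) x y e (f e) :=
        fun e => le_join _ x y (show f.SameCycle e (f e) from ⟨1, rfl⟩)
      have hsw : join (Perm.SameCycle.setoid f) x y d (swap x y d) := by
        by_cases h1 : d = x
        · subst h1; rw [swap_apply_left]; exact join_pair _ _ _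
        by_cases h2 : d = y
        · subst h2; rw [swap_apply_right]; exact (join _ _ _).symm (join_pair _ _ _)
        rw [swap_apply_of_ne_of_ne h1 h2]
      exact (join _ x y).trans hsw (hstep _)
    · apply join_le _ (merge_same f h)
      apply sc_le
      intro d
      have hsw : (f * swap x y).SameCycle d (swap x y d) := by
        by_cases h1 : d = x
        · subst h1; rw [swap_apply_left]; exact merge_same f h
        by_cases h2 : d = y
        · subst h2; rw [swap_apply_right]; exact (merge_same f h).symm
        rw [swap_apply_of_ne_of_ne h1 h2]
      exact hsw.trans ⟨1, by simp⟩
  unfold cc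
  rw [this]
  exact nc_join h

theorem cc_split (f : Perm D) {x y : D} (hne : x ≠ y) (h : f.SameCycle x y) :
    cc (f * swap x y) = cc f + 1 := by
  have := cc_merge (f * swap x y) (split_not_same f hne h)
  rw [mul_assoc, swap_mul_self, mul_one] at this
  exact this.symm

/-- component relation -/
def comp (σ α : Perm D) : Setoid D :=
  Relation.EqvGen.setoid (fun d e : D => e = σ d ∨ e = α d)

theorem comp_le {σ α : Perm D} {s : Setoid D} (h1 : ∀ d, s d (σ d)) (h2 : ∀ d, s d (α d)) :
    comp σ α ≤ s := by
  intro a b hab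
  change Relation.EqvGen _ a b at hab
  induction hab with
  | rel a b h => rcases h with rfl | rfl; exacts [h1 _, h2 _]
  | refl => exact s.refl _
  | symm _ _ _ ih => exact s.symm ih
  | trans _ _ _ _ _ ih1 ih2 => exact s.trans ih1 ih2

theorem comp_left (σ α : Perm D) (d : D) : comp σ α d (σ d) := .rel _ _ (Or.inl rfl)
theorem comp_right (σ α : Perm D) (d : D) : comp σ α d (α d) := .rel _ _ (Or.inr rfl)

theorem rel_swap {s : Setoid D} {x y : D} (h : s x y) (d : D) : s d (swap x y d) := by
  by_cases h1 : d = x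
  · subst h1; rw [swap_apply_left]; exact h
  by_cases h2 : d = y
  · subst h2; rw [swap_apply_right]; exact s.symm h
  rw [swap_apply_of_ne_of_ne h1 h2]

/-- Genus is nonnegative. -/
theorem genus_aux (σ : Perm D) (n : ℕ) : ∀ α : Perm D, n + cc α = Fintype.card D →
    cc σ + cc α + cc (σ * α) ≤ Fintype.card D + 2 * nc (comp σ α) := by
  induction n with
  | zero =>
    intro α hα
    have h1 : α = 1 := by
      by_contra hne
      obtain ⟨x, hx⟩ : ∃ x, α x ≠ x := by
        by_contra hcon
        push Not at hcon
        exact hne (Equiv.ext hcon)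
      have := cc_split α (x := x) (y := α x) hx.symm ⟨1, rfl⟩
      have hle : cc (α * swap x (α x)) ≤ Fintype.card D := by
        unfold cc nc
        rw [← Nat.card_eq_fintype_card]
        exact Nat.card_le_card_of_surjective _ Quotient.mk_surjective
      omega
    subst h1
    have : cc σ ≤ nc (comp σ 1) := nc_mono (comp_le (s := Perm.SameCycle.setoid σ)
      (fun d => ⟨1, rfl⟩) (fun d => Setoid.refl' _ _))
    rw [mul_one]
    omega
  | succ n ih =>
    intro α hα
    have h1 : α ≠ 1 := by
      rintro rfl
      have : Fintype.card D ≤ cc (1 : Perm D) := by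
        unfold cc nc
        rw [← Nat.card_eq_fintype_card]
        refine Nat.card_le_card_of_injective (fun d => Quotient.mk _ d) ?_
        intro a b hab
        have := Quotient.exact hab
        exact Perm.sameCycle_one.1 this
      omega
    obtain ⟨x, hx⟩ : ∃ x, α x ≠ x := by
      by_contra hcon
      push Not at hcon
      exact h1 (Equiv.ext hcon)
    obtain ⟨y, hy⟩ : ∃ y, y = α x := ⟨_, rfl⟩
    have hsp := cc_split α (x := x) (y := y) (by rw [hy]; exact hx.symm) ⟨1, by simp [hy]⟩
    set α' := α * swap x y with hα'
    have hback : α = α' * swap x y := by rw [hα', mul_assoc, swap_mul_self, mul_one]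
    have hIH := ih α' (by omega)
    by_cases hc : comp σ α' x y
    · have hle : nc (comp σ α') ≤ nc (comp σ α) := by
        apply nc_mono
        apply comp_le (comp_left _ _)
        intro d
        rw [hback]
        exact Setoid.trans' _ (rel_swap hc d) (comp_right _ _ _)
      have : cc (σ * α) ≤ cc (σ * α') + 1 := by
        rw [hback, ← mul_assoc]
        by_cases hs : (σ * α').SameCycle x y
        · rw [cc_split _ (by rw [hy]; exact hx.symm) hs]
        · have := cc_merge _ hs
          omega
      omega
    · have hle : nc (join (comp σ α') x y) ≤ nc (comp σ α) := by
        apply nc_mono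
        apply comp_le
        · intro d; exact le_join _ _ _ (comp_left _ _ _)
        · intro d
          rw [hback]
          exact Setoid.trans' _ (rel_swap (join_pair _ _ _) d) (le_join _ _ _ (comp_right _ _ _))
      have h2 := nc_join hc
      have hs : ¬ (σ * α').SameCycle x y := by
        intro hs
        apply hc
        refine (sc_le (f := σ * α') (s := comp σ α') ?_) hs
        intro d
        exact Setoid.trans' _ (comp_right σ α' d) (comp_left _ _ _)
      have h3 := cc_merge _ hs
      rw [mul_assoc, ← hback] at h3
      omega

theorem genus (σ α : Perm D) :
    cc σ + cc α + cc (σ * α) ≤ Fintype.card D + 2 * nc (comp σ α) := by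
  refine genus_aux σ (Fintype.card D - cc α) α ?_
  have hle : cc α ≤ Fintype.card D := by
    unfold cc nc
    rw [← Nat.card_eq_fintype_card]
    exact Nat.card_le_card_of_surjective _ Quotient.mk_surjective
  omega

theorem card_le_two_cc (α : Perm D) (h : ∀ d, α (α d) = d) : Fintype.card D ≤ 2 * cc α := by
  classical
  unfold cc nc
  rw [← Nat.card_eq_fintype_card]
  have : Nat.card (Bool × Quotient (Perm.SameCycle.setoid α)) =
      2 * Nat.card (Quotient (Perm.SameCycle.setoid α)) := by simp
  rw [← this]
  refine Nat.card_le_card_of_surjective (fun q => if q.1 then q.2.out else α q.2.out) ?_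
  intro d
  have h1 : α.SameCycle (Quotient.mk (Perm.SameCycle.setoid α) d).out d :=
    Quotient.exact (Quotient.out_eq (Quotient.mk (Perm.SameCycle.setoid α) d))
  set e := (Quotient.mk (Perm.SameCycle.setoid α) d).out with he
  obtain ⟨n, hn⟩ := h1.exists_nat_pow_eq
  have : (α ^ n) e = e ∨ (α ^ n) e = α e := by
    clear hn
    induction n with
    | zero => left; rfl
    | succ n ih =>
      rw [pow_succ', Perm.mul_apply]
      rcases ih with ih | ih <;> rw [ih]
      · right; rfl
      · left; exact h e
  rw [hn] at this
  rcases this with h2 | h2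
  · exact ⟨(true, Quotient.mk _ d), by simp only [if_true]; rw [← he]; exact h2.symm⟩
  · refine ⟨(false, Quotient.mk _ d), ?_⟩
    simp only [Bool.false_eq_true, if_false]
    rw [← he]; exact h2.symm

open Classical in
/-- reverse a permutation on an invariant set -/
noncomputable def flip (f : Perm D) (S : Set D) (h : ∀ d, f d ∈ S ↔ d ∈ S) : Perm D where
  toFun d := if d ∈ S then f⁻¹ d else f d
  invFun d := if d ∈ S then f d else f⁻¹ d
  left_inv d := by
    have h' : f⁻¹ d ∈ S ↔ d ∈ S := by rw [← h (f⁻¹ d)]; simp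
    by_cases hd : d ∈ S
    · simp only [hd, if_true, h'.2 hd]; simp
    · simp only [hd, if_false, mt (h d).1 hd]; simp
  right_inv d := by
    have h' : f⁻¹ d ∈ S ↔ d ∈ S := by rw [← h (f⁻¹ d)]; simp
    by_cases hd : d ∈ S
    · simp only [hd, if_true, (h d).2 hd]; simp
    · simp only [hd, if_false, mt h'.1 hd]; simp

theorem flip_in {f : Perm D} {S : Set D} (h) {d : D} (hd : d ∈ S) : flip f S h d = f⁻¹ d := by
  classical exact if_pos hd
theorem flip_out {f : Perm D} {S : Set D} (h) {d : D} (hd : d ∉ S) : flip f S h d = f d := by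
  classical exact if_neg hd

theorem flip_sc (f : Perm D) (S : Set D) (h) :
    Perm.SameCycle.setoid (flip f S h) = Perm.SameCycle.setoid f := by
  apply le_antisymm
  · apply sc_le
    intro d
    by_cases hd : d ∈ S
    · rw [flip_in h hd]; exact ⟨-1, by simp⟩
    · rw [flip_out h hd]; exact ⟨1, by simp⟩
  · apply sc_le
    intro d
    by_cases hd : d ∈ S
    · refine Setoid.symm' _ (show (flip f S h).SameCycle (f d) d from ⟨1, ?_⟩)
      rw [zpow_one, flip_in h ((h d).2 hd)]; simp
    · exact ⟨1, by rw [zpow_one, flip_out h hd]⟩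

theorem cc_conj (g f : Perm D) : cc (g * f * g⁻¹) = cc f := by
  unfold cc nc
  refine Nat.card_congr (Quotient.congr g⁻¹ ?_)
  intro a b
  exact Perm.sameCycle_conj

theorem cc_flip (σ α : Perm D) (hα : ∀ d, α (α d) = d) (S : Set D)
    (h : ∀ d, σ d ∈ S ↔ d ∈ S) (h2 : ∀ d, α d ∈ S ↔ d ∈ S) :
    cc (flip σ S h * α) = cc (σ * α) := by
  classical
  have h3 : ∀ d, (σ * α) d ∈ S ↔ d ∈ S := fun d => by rw [Perm.mul_apply, h, h2]
  have hi : α⁻¹ = α := by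
    ext d; rw [Perm.inv_eq_iff_eq]; exact (hα d).symm
  have hgi : Function.Involutive (fun d => if d ∈ S then α d else d) := by
    intro d
    by_cases hd : d ∈ S
    · simp only [hd, if_true, (h2 d).2 hd, hα]
    · simp only [hd, if_false]
  let g : Perm D := hgi.toPerm
  have hg1 : ∀ d ∈ S, g d = α d := fun d hd => if_pos hd
  have hg2 : ∀ d, d ∉ S → g d = d := fun d hd => if_neg hd
  have hginv : g⁻¹ = g := by
    ext d; rw [Perm.inv_eq_iff_eq]; exact (hgi d).symm
  have key : flip σ S h * α = g * flip (σ * α) S h3 * g⁻¹ := by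
    ext d
    rw [hginv]
    simp only [Perm.mul_apply]
    by_cases hd : d ∈ S
    · rw [hg1 d hd, flip_in h ((h2 d).2 hd), flip_in h3 ((h2 d).2 hd), mul_inv_rev, hi,
        Perm.mul_apply, hg1, hα]
      rw [h2, ← h]; simp [h2, hd]
    · rw [hg2 d hd, flip_out h (mt (h2 d).1 hd), flip_out h3 hd, hg2]
      · rfl
      · exact mt (h3 d).1 hd
  rw [key, cc_conj]
  unfold cc
  rw [flip_sc]

theorem perm_apply_inv {D : Type} (f : Perm D) (d : D) : f (f⁻¹ d) = d := by simp
theorem perm_inv_apply {D : Type} (f : Perm D) (d : D) : f⁻¹ (f d) = d := by simp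

theorem pivot (ρ α : Perm D) (hα : ∀ d, α (α d) = d)
    (hpl : Fintype.card D + 2 * nc (comp ρ α) ≤ cc ρ + cc α + cc (ρ * α))
    {p a b q p1 q1 p2 q2 : D} (hp : ρ p = a) (ha : ρ a = b) (hb : ρ b = q) (hq : ρ q = p)
    (e1 : α q = p1) (r1 : ρ p1 = q1) (e2 : α q1 = p2) (r2 : ρ p2 = q2) (e3 : α q2 = p)
    (hpb : p ≠ b) (hqp : q ≠ p) (hqb : q ≠ b) (hap : a ≠ p)
    (h1p : p1 ≠ p) (h1q : p1 ≠ q) (h2p : p2 ≠ p) (h2q : p2 ≠ q) :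
    ∃ (S : Set D) (h : ∀ d, ρ d ∈ S ↔ d ∈ S), p ∈ S ∧ p1 ∉ S ∧ p2 ∉ S ∧
      (∀ d ∈ S, d ≠ p → d ≠ q → α d ∈ S) ∧ cc (flip ρ S h * α) = cc (ρ * α) := by
  classical
  have haq : a ≠ q := fun h => hpb (ρ.injective (by rw [hp, hb, h]))
  have hinvα : α⁻¹ = α := by
    ext d; rw [Perm.inv_eq_iff_eq]; exact (hα d).symm
  obtain ⟨τ, hτ⟩ : ∃ τ, τ = ρ * swap p b := ⟨_, rfl⟩
  have τp : τ p = q := by rw [hτ, Perm.mul_apply, swap_apply_left, hb]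
  have τb : τ b = a := by rw [hτ, Perm.mul_apply, swap_apply_right, hp]
  have τo : ∀ d, d ≠ p → d ≠ b → τ d = ρ d := fun d h h' => by
    rw [hτ, Perm.mul_apply, swap_apply_of_ne_of_ne h h']
  have hback : ρ = τ * swap p b := by rw [hτ, mul_assoc, swap_mul_self, mul_one]
  have hV : cc τ = cc ρ + 1 := by
    rw [hτ]
    apply cc_split _ hpb
    exact ⟨(2 : ℕ) + 0, by rw [add_zero, zpow_natCast, pow_two, Perm.mul_apply, hp, ha]⟩
  have hconj : ∀ (f : Perm D) (x y : D), f * swap x y * α = f * α * swap (α x) (α y) := by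
    intro f x y
    rw [mul_assoc, mul_assoc]
    congr 1
    have := Equiv.mul_swap_eq_swap_mul α (α x) (α y)
    rw [hα, hα] at this
    exact this.symm
  have hF : cc (τ * α) = cc (ρ * α) + 1 := by
    rw [hτ, hconj]
    apply cc_split
    · exact fun h => hpb (α.injective h)
    · have s1 : (ρ * α) (α b) = q := by rw [Perm.mul_apply, hα, hb]
      have s2 : (ρ * α) q = q1 := by rw [Perm.mul_apply, e1, r1]
      have s3 : (ρ * α) q1 = q2 := by rw [Perm.mul_apply, e2, r2]
      have s4 : α p = q2 := by rw [← e3, hα]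
      rw [s4]
      symm
      refine ⟨(3 : ℕ), ?_⟩
      rw [zpow_natCast, pow_succ, pow_two, Perm.mul_apply, Perm.mul_apply, s1, s2, s3]
  have hpb' : ¬ comp τ α p b := by
    intro hc
    have hle : nc (comp τ α) ≤ nc (comp ρ α) := by
      apply nc_mono
      refine comp_le ?_ (comp_right _ _)
      intro d
      rw [hback]
      exact Setoid.trans' _ (rel_swap hc d) (comp_left _ _ _)
    have := genus τ α
    omega
  let S : Set D := {d | comp τ α b d}
  have Sτ : ∀ d, τ d ∈ S ↔ d ∈ S := fun d =>
    ⟨fun h => Setoid.trans' _ h (Setoid.symm' _ (comp_left τ α d)),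
     fun h => Setoid.trans' _ h (comp_left τ α d)⟩
  have Sα : ∀ d, α d ∈ S ↔ d ∈ S := fun d =>
    ⟨fun h => Setoid.trans' _ h (Setoid.symm' _ (comp_right τ α d)),
     fun h => Setoid.trans' _ h (comp_right τ α d)⟩
  have pS : p ∉ S := fun h => hpb' (Setoid.symm' _ h)
  have qS : q ∉ S := by rw [← τp, Sτ]; exact pS
  have bS : b ∈ S := Setoid.refl' (comp τ α) b
  have aS : a ∈ S := by rw [← τb, Sτ]; exact bS
  have p1S : p1 ∉ S := by rw [← e1, Sα]; exact qS
  have q1S : q1 ∉ S := by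
    rw [← r1, ← τo p1 h1p (fun h => p1S (h ▸ bS)), Sτ]; exact p1S
  have p2S : p2 ∉ S := by rw [← e2, Sα]; exact q1S
  let S' : Set D := {d | d ∈ S ∨ d = p ∨ d = q}
  have S'ρ : ∀ d, ρ d ∈ S' ↔ d ∈ S' := by
    intro d
    by_cases h1 : d = p
    · subst h1; rw [hp]; exact ⟨fun _ => Or.inr (Or.inl rfl), fun _ => Or.inl aS⟩
    by_cases h2 : d = b
    · subst h2; rw [hb]; exact ⟨fun _ => Or.inl bS, fun _ => Or.inr (Or.inr rfl)⟩
    by_cases h3 : d = q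
    · subst h3; rw [hq]; exact ⟨fun _ => Or.inr (Or.inr rfl), fun _ => Or.inr (Or.inl rfl)⟩
    have n1 : ρ d ≠ p := fun h => h3 (ρ.injective (by rw [h, hq]))
    have n2 : ρ d ≠ q := fun h => h2 (ρ.injective (by rw [h, hb]))
    have := Sτ d
    rw [τo d h1 h2] at this
    change (ρ d ∈ S ∨ ρ d = p ∨ ρ d = q) ↔ (d ∈ S ∨ d = p ∨ d = q)
    simp only [n1, n2, h1, h3, or_false, this]
  refine ⟨S', S'ρ, Or.inr (Or.inl rfl), ?_, ?_, ?_, ?_⟩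
  · rintro (h | h | h); exacts [p1S h, h1p h, h1q h]
  · rintro (h | h | h); exacts [p2S h, h2p h, h2q h]
  · rintro d (h | h | h) n1 n2
    · exact Or.inl ((Sα d).2 h)
    · exact absurd h n1
    · exact absurd h n2
  · have hfl : flip ρ S' S'ρ = flip τ S Sτ * swap q a := by
      ext d
      rw [Perm.mul_apply]
      by_cases h1 : d = q
      · subst h1
        rw [swap_apply_left, flip_in _ aS, flip_in S'ρ (show _ ∈ S' from Or.inr (Or.inr rfl))]
        rw [Perm.inv_eq_iff_eq.2 τb.symm, Perm.inv_eq_iff_eq.2 hb.symm]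
      by_cases h2 : d = a
      · subst h2
        rw [swap_apply_right, flip_out _ qS, flip_in S'ρ (show _ ∈ S' from Or.inl aS), τo q hqp hqb, hq]
        rw [Perm.inv_eq_iff_eq.2 hp.symm]
      rw [swap_apply_of_ne_of_ne h1 h2]
      by_cases h3 : d = p
      · subst h3
        rw [flip_out _ pS, flip_in S'ρ (show _ ∈ S' from Or.inr (Or.inl rfl)), τp, Perm.inv_eq_iff_eq.2 hq.symm]
      by_cases h4 : d ∈ S
      · rw [flip_in _ h4, flip_in S'ρ (show _ ∈ S' from Or.inl h4)]
        symm
        rw [Perm.inv_eq_iff_eq, τo, perm_apply_inv]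
        · intro h; apply h2; rw [← hp, ← h, perm_apply_inv]
        · intro h; apply h1; rw [← hb, ← h, perm_apply_inv]
      · have : d ∉ S' := by
          rintro (h | h | h); exacts [h4 h, h3 h, h1 h]
        rw [flip_out _ h4, flip_out _ this, τo d h3 (fun h => h4 (h ▸ bS))]
    rw [hfl, hconj]
    have hinv : ∀ d, (flip τ S Sτ * α) d ∈ S ↔ d ∈ S := by
      intro d
      rw [Perm.mul_apply]
      by_cases h : α d ∈ S
      · rw [flip_in _ h, ← Sτ, perm_apply_inv, Sα]
      · rw [flip_out _ h, Sτ, Sα]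
    have hns : ¬ (flip τ S Sτ * α).SameCycle (α q) (α a) := by
      intro hsc
      have : Setoid.ker (fun d => d ∈ S) (α q) (α a) := by
        refine sc_le (f := flip τ S Sτ * α) ?_ hsc
        intro d
        exact propext (hinv d).symm
      have h' : (α q ∈ S) = (α a ∈ S) := this
      rw [Sα, Sα] at h'
      exact qS (h' ▸ aS)
    have h1 := cc_merge _ hns
    have h2 := cc_flip τ α hα S Sτ Sα
    omega

end XP

namespace XP
open Equiv
set_option linter.unusedSectionVars false

theorem period_of_card {D : Type} [Fintype D] (f : Perm D) (d : D) {n : ℕ}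
    (h : Nat.card {e : D // f.SameCycle d e} = n) :
    (f ^ n) d = d ∧ (∀ k, 0 < k → k < n → (f ^ k) d ≠ d) ∧
      ∀ e, f.SameCycle d e → ∃ k < n, (f ^ k) d = e := by
  classical
  have hper : d ∈ Function.periodicPts f := by
    refine ⟨orderOf f, orderOf_pos f, ?_⟩
    change f^[orderOf f] d = d
    rw [← Perm.coe_pow, pow_orderOf_eq_one]; rfl
  have hpos := Function.minimalPeriod_pos_of_mem_periodicPts hper
  have hsur : ∀ e, f.SameCycle d e → ∃ k < Function.minimalPeriod f d, (f ^ k) d = e := by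
    intro e he
    obtain ⟨m, rfl⟩ := he.exists_nat_pow_eq
    refine ⟨m % Function.minimalPeriod f d, Nat.mod_lt _ hpos, ?_⟩
    rw [Perm.coe_pow, Perm.coe_pow, Function.iterate_mod_minimalPeriod_eq]
  have hcard : Nat.card (Fin (Function.minimalPeriod f d)) = n := by
    rw [← h]
    refine Nat.card_eq_of_bijective
      (fun k : Fin (Function.minimalPeriod f d) =>
        (⟨(f ^ (k : ℕ)) d, ⟨(k : ℕ), by rw [zpow_natCast]⟩⟩ : {e : D // f.SameCycle d e})) ⟨?_, ?_⟩
    · intro i j hij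
      have := congrArg Subtype.val hij
      simp only [Perm.coe_pow] at this
      exact Fin.ext (Function.iterate_injOn_Iio_minimalPeriod i.2 j.2 this)
    · rintro ⟨e, he⟩
      obtain ⟨k, hk, hke⟩ := hsur e he
      exact ⟨⟨k, hk⟩, Subtype.ext hke⟩
  rw [Nat.card_fin] at hcard
  rw [hcard] at hsur
  refine ⟨?_, ?_, hsur⟩
  · rw [Perm.coe_pow, ← hcard]; exact Function.iterate_minimalPeriod
  · intro k hk hkn he
    rw [Perm.coe_pow] at he
    rw [← hcard] at hkn
    exact Function.not_isPeriodicPt_of_pos_of_lt_minimalPeriod (by omega) hkn he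

section compat
variable {H : StarGraph} {ρ : Perm H.D}

theorem compat_sc (hc : H.IsCompatibleRotation ρ) :
    Perm.SameCycle.setoid ρ = Perm.SameCycle.setoid H.rot := by
  apply le_antisymm
  · apply sc_le
    intro d
    rcases hc d with h | h
    · rw [h d (Perm.SameCycle.refl _ _)]; exact ⟨1, by simp⟩
    · rw [h d (Perm.SameCycle.refl _ _)]; exact ⟨-1, by simp⟩
  · apply sc_le
    intro d
    rcases hc d with h | h
    · rw [← h d (Perm.SameCycle.refl _ _)]; exact ⟨1, by simp⟩
    · refine Setoid.symm' _ (show ρ.SameCycle (H.rot d) d from ⟨1, ?_⟩)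
      rw [zpow_one, h (H.rot d) ⟨1, by simp⟩]; simp

theorem compat_flip (hc : H.IsCompatibleRotation ρ) (S : Set H.D) (hS) :
    H.IsCompatibleRotation (flip ρ S hS) := by
  intro d
  have hmem : ∀ e, H.SameVertex d e → (e ∈ S ↔ d ∈ S) := by
    intro e he
    have h1 : ρ.SameCycle d e := by
      have : Perm.SameCycle.setoid H.rot d e := he
      rw [← compat_sc hc] at this
      exact this
    have : Setoid.ker (fun d => d ∈ S) d e := by
      refine sc_le (f := ρ) ?_ h1
      intro d
      exact propext (hS d).symm
    exact (Eq.to_iff this).symm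
  by_cases hd : d ∈ S
  · rcases hc d with h | h
    · right
      intro e he
      rw [flip_in hS ((hmem e he).2 hd), Perm.inv_eq_iff_eq, h, perm_apply_inv]
      exact he.trans ⟨-1, by simp⟩
    · left
      intro e he
      rw [flip_in hS ((hmem e he).2 hd), Perm.inv_eq_iff_eq, h, perm_inv_apply]
      exact he.trans ⟨1, by simp⟩
  · rcases hc d with h | h
    · left
      intro e he
      rw [flip_out hS (mt (hmem e he).1 hd), h e he]
    · right
      intro e he
      rw [flip_out hS (mt (hmem e he).1 hd), h e he]

theorem planar_ineq (h : H.IsPlanarStarEmbedding ρ) :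
    Fintype.card H.D + 2 * nc (comp ρ H.edgeInv) ≤
      cc ρ + cc H.edgeInv + cc (ρ * H.edgeInv) := by
  obtain ⟨hc, he⟩ := h
  have h1 : cc ρ = H.numVertices := by
    unfold cc; rw [compat_sc hc]; rfl
  have h2 : cc (ρ * H.edgeInv) = H.numFaces ρ := rfl
  have h3 : nc (comp ρ H.edgeInv) ≤ H.numComponents := by
    refine nc_mono (r := comp H.rot H.edgeInv) ?_
    refine comp_le ?_ (comp_right _ _)
    intro d
    have h4 : Perm.SameCycle.setoid ρ d (H.rot d) := by
      rw [compat_sc hc]; exact ⟨1, by simp⟩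
    exact sc_le (comp_left ρ H.edgeInv) h4
  have h4 := card_le_two_cc H.edgeInv H.edgeInv_invol
  have h5 : H.numEdges = Fintype.card H.D / 2 := rfl
  omega

theorem planar_flip (h : H.IsPlanarStarEmbedding ρ) (S : Set H.D) (hS)
    (he : cc (flip ρ S hS * H.edgeInv) = cc (ρ * H.edgeInv)) :
    H.IsPlanarStarEmbedding (flip ρ S hS) := by
  refine ⟨compat_flip h.1 S hS, ?_⟩
  have h2 : H.numFaces (flip ρ S hS) = H.numFaces ρ := he
  rw [h2]
  exact h.2

end compat

section expansion
variable {G G' : StarGraph} (E : ExpansionData G G')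

theorem deg_same {x y : G.D} (h : G.SameVertex x y) : G.degree y = G.degree x := by
  unfold StarGraph.degree
  refine Nat.card_congr (Equiv.subtypeEquivRight ?_)
  intro e
  exact ⟨fun he => h.trans he, fun he => (h.symm).trans he⟩

theorem sv_pow (x : G.D) (n : ℕ) : G.SameVertex x ((G.rot ^ n) x) := ⟨n, by rw [zpow_natCast]⟩

theorem leader_two {x : G.D} (hd : G.degree x = 6) : E.leader ((G.rot ^ 2) x) ↔ E.leader x := by
  have h1 := E.leader_alt x hd
  have h2 := E.leader_alt (G.rot x) (by rw [deg_same (show G.SameVertex x (G.rot x) from ⟨1, by simp⟩), hd])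
  rw [pow_two, Perm.mul_apply]
  tauto

theorem leader_four {x : G.D} (hd : G.degree x = 6) : E.leader ((G.rot ^ 4) x) ↔ E.leader x := by
  have h1 := leader_two E (x := (G.rot ^ 2) x) (by rw [deg_same (sv_pow x 2), hd])
  rw [leader_two E hd, ← Perm.mul_apply, ← pow_add] at h1
  exact h1

theorem rot6 {x : G.D} (hd : G.degree x = 6) : (G.rot ^ 6) x = x := (period_of_card _ _ hd).1
theorem rot2_ne {x : G.D} (hd : G.degree x = 6) : (G.rot ^ 2) x ≠ x :=
  (period_of_card _ _ hd).2.1 2 (by omega) (by omega)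
theorem rot4_ne {x : G.D} (hd : G.degree x = 6) : (G.rot ^ 4) x ≠ x :=
  (period_of_card _ _ hd).2.1 4 (by omega) (by omega)
theorem rot24 {x : G.D} : (G.rot ^ 2) ((G.rot ^ 2) x) = (G.rot ^ 4) x := by
  rw [← Perm.mul_apply, ← pow_add]
theorem rot26 {x : G.D} (hd : G.degree x = 6) : (G.rot ^ 2) ((G.rot ^ 4) x) = x := by
  rw [← Perm.mul_apply, ← pow_add]; exact rot6 hd
theorem rot46 {x : G.D} (hd : G.degree x = 6) : (G.rot ^ 4) ((G.rot ^ 2) x) = x := by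
  rw [← Perm.mul_apply, ← pow_add]; exact rot6 hd
theorem rot48 {x : G.D} (hd : G.degree x = 6) : (G.rot ^ 4) ((G.rot ^ 4) x) = (G.rot ^ 2) x := by
  rw [← rot24 (x := (G.rot ^ 4) x), rot26 hd]
theorem rot42_ne {x : G.D} (hd : G.degree x = 6) : (G.rot ^ 4) x ≠ (G.rot ^ 2) x := by
  rw [← rot24]; exact rot2_ne (by rw [deg_same (sv_pow x 2), hd])

theorem leaders {x y : G.D} (hd : G.degree x = 6) (hx : E.leader x) (h : G.SameVertex x y)
    (hy : E.leader y) : y = x ∨ y = (G.rot ^ 2) x ∨ y = (G.rot ^ 4) x := by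
  obtain ⟨k, hk, rfl⟩ := (period_of_card _ _ hd).2.2 y h
  have hodd : ∀ z, G.SameVertex x z → E.leader z → ¬ E.leader (G.rot z) := fun z hz hl =>
    (E.leader_alt z (by rw [deg_same hz, hd])).1 hl
  have h2 := (leader_two E hd).2 hx
  have h4 := (leader_four E hd).2 hx
  interval_cases k
  · left; rfl
  · exact absurd hy (hodd x (sv_pow x 0) hx)
  · right; left; rfl
  · refine absurd hy ?_
    rw [pow_succ', Perm.mul_apply]; exact hodd _ (sv_pow x 2) h2
  · right; right; rfl
  · refine absurd hy ?_
    rw [pow_succ', Perm.mul_apply]; exact hodd _ (sv_pow x 4) h4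

theorem not_leader_rot {x : G.D} (hd : G.degree x = 6) (hx : E.leader x) : ¬ E.leader (G.rot x) :=
  (E.leader_alt x hd).1 hx

theorem L_inj {x y : G.D} (hd : G.degree x = 6) (hx : E.leader x) (hd' : G.degree y = 6)
    (hy : E.leader y) (h : E.L x = E.L y) : x = y := by
  rw [← E.six_oppL x hd hx, ← E.six_oppL y hd' hy] at h
  exact G.rot.injective (E.ι_inj ((G'.rot ^ 2).injective h))

theorem R_inj {x y : G.D} (hd : G.degree x = 6) (hx : E.leader x) (hd' : G.degree y = 6)
    (hy : E.leader y) (h : E.R x = E.R y) : x = y := by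
  rw [← E.six_oppR x hd hx, ← E.six_oppR y hd' hy] at h
  exact (E.ι_inj ((G'.rot ^ 2).injective h))

theorem L_ne_R {x y : G.D} (hd : G.degree x = 6) (hx : E.leader x) (hd' : G.degree y = 6)
    (hy : E.leader y) : E.L x ≠ E.R y := by
  intro h
  rw [← E.six_oppL x hd hx, ← E.six_oppR y hd' hy] at h
  have := (E.ι_inj ((G'.rot ^ 2).injective h))
  exact not_leader_rot E hd hx (this ▸ hy)

/-- positive orientation at the new vertex of `x` -/
def Pos (ρ : Perm G'.D) (x : G.D) : Prop := ρ (E.L x) = E.ι x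

theorem frame {ρ : Perm G'.D} (hc : G'.IsCompatibleRotation ρ) {x : G.D} (hd : G.degree x = 6)
    (hx : E.leader x) :
    (Pos E ρ x ∧ ρ (E.L x) = E.ι x ∧ ρ (E.ι x) = E.ι (G.rot x) ∧ ρ (E.ι (G.rot x)) = E.R x ∧
      ρ (E.R x) = E.L x) ∨
    (¬ Pos E ρ x ∧ ρ (E.R x) = E.ι (G.rot x) ∧ ρ (E.ι (G.rot x)) = E.ι x ∧ ρ (E.ι x) = E.L x ∧
      ρ (E.L x) = E.R x) := by
  have hR := E.six_oppR x hd hx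
  have hL := E.six_oppL x hd hx
  have hnew := E.new_not_old x
  obtain ⟨p4, -, hk⟩ := period_of_card G'.rot (E.ι x) (E.regular4 (E.ι x))
  obtain ⟨k, hk4, hke⟩ := hk _ (E.six_sameVertex x hd hx)
  have hrx : G.rot x ≠ x := fun h => not_leader_rot E hd hx (by rw [h]; exact hx)
  have key : (G'.rot (E.L x) = E.ι x ∧ G'.rot (E.ι x) = E.ι (G.rot x) ∧
        G'.rot (E.ι (G.rot x)) = E.R x ∧ G'.rot (E.R x) = E.L x) ∨
      (G'.rot (E.R x) = E.ι (G.rot x) ∧ G'.rot (E.ι (G.rot x)) = E.ι x ∧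
        G'.rot (E.ι x) = E.L x ∧ G'.rot (E.L x) = E.R x) := by
    have q2 : ∀ d, (G'.rot ^ 2) d = G'.rot (G'.rot d) := fun d => by rw [pow_two]; rfl
    have q3 : ∀ d, (G'.rot ^ 3) d = G'.rot (G'.rot (G'.rot d)) := fun d => by
      rw [pow_succ', Perm.mul_apply, q2]
    have q4 : ∀ d, (G'.rot ^ 4) d = G'.rot (G'.rot (G'.rot (G'.rot d))) := fun d => by
      rw [pow_succ', Perm.mul_apply, q3]
    rw [q2] at hR hL
    rw [q4] at p4
    interval_cases k
    · exact absurd (E.ι_inj hke).symm hrx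
    · left
      rw [pow_one] at hke
      rw [hke] at hR p4
      rw [hR] at hL p4
      rw [hL] at p4
      exact ⟨p4, hke, hR, hL⟩
    · rw [q2, hR] at hke
      exact absurd hke (hnew _ hd hx).2
    · right
      rw [q3, hR] at hke
      rw [hR, hke] at p4
      rw [p4] at hL
      rw [hL] at hR
      exact ⟨hke, p4, hL, hR⟩
  have n1 : E.R x ≠ E.ι x := (hnew _ hd hx).2
  have v0 : G'.SameVertex (E.ι x) (E.ι x) := Perm.SameCycle.refl _ _
  have v1 : G'.SameVertex (E.ι x) (E.ι (G.rot x)) := E.six_sameVertex x hd hx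
  have v2 : G'.SameVertex (E.ι x) (E.R x) := by rw [← hR]; exact sv_pow _ 2
  have v3 : G'.SameVertex (E.ι x) (E.L x) := by rw [← hL]; exact v1.trans (sv_pow _ 2)
  rcases key with ⟨k1, k2, k3, k4⟩ | ⟨k1, k2, k3, k4⟩ <;> rcases hc (E.ι x) with h | h
  · left
    unfold Pos
    rw [h _ v0, h _ v1, h _ v2, h _ v3]
    exact ⟨k1, k1, k2, k3, k4⟩
  · right
    unfold Pos
    rw [h _ v0, h _ v1, h _ v2, h _ v3, Perm.inv_eq_iff_eq.2 k1.symm, Perm.inv_eq_iff_eq.2 k2.symm,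
      Perm.inv_eq_iff_eq.2 k3.symm, Perm.inv_eq_iff_eq.2 k4.symm]
    exact ⟨n1, rfl, rfl, rfl, rfl⟩
  · right
    unfold Pos
    rw [h _ v0, h _ v1, h _ v2, h _ v3]
    rw [k4]
    exact ⟨n1, k1, k2, k3, rfl⟩
  · left
    unfold Pos
    rw [h _ v0, h _ v1, h _ v2, h _ v3, Perm.inv_eq_iff_eq.2 k1.symm, Perm.inv_eq_iff_eq.2 k2.symm,
      Perm.inv_eq_iff_eq.2 k3.symm, Perm.inv_eq_iff_eq.2 k4.symm]
    exact ⟨rfl, rfl, rfl, rfl, rfl⟩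

/-- invariant sets contain both or none of `L x`, `R x` -/
theorem mem_LR {ρ : Perm G'.D} (hc : G'.IsCompatibleRotation ρ) {x : G.D} (hd : G.degree x = 6)
    (hx : E.leader x) {S : Set G'.D} (hS : ∀ d, ρ d ∈ S ↔ d ∈ S) : E.R x ∈ S ↔ E.L x ∈ S := by
  rcases frame E hc hd hx with ⟨-, -, -, -, h⟩ | ⟨-, -, -, -, h⟩
  · rw [← h, hS]
  · rw [← h, hS]

theorem pos_flip_in {ρ : Perm G'.D} (hc : G'.IsCompatibleRotation ρ) {x : G.D}
    (hd : G.degree x = 6) (hx : E.leader x) {S : Set G'.D} (hS) (h : E.L x ∈ S) :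
    Pos E (flip ρ S hS) x ↔ ¬ Pos E ρ x := by
  have n1 : E.R x ≠ E.ι x := (E.new_not_old x _ hd hx).2
  unfold Pos
  rw [flip_in hS h]
  rcases frame E hc hd hx with ⟨h0, h1, h2, h3, h4⟩ | ⟨h0, h1, h2, h3, h4⟩
  · rw [Perm.inv_eq_iff_eq.2 h4.symm, h1]; simp [n1]
  · rw [Perm.inv_eq_iff_eq.2 h3.symm, h4]; simp [n1]

theorem pos_flip_out {ρ : Perm G'.D} {x : G.D} {S : Set G'.D} (hS) (h : E.L x ∉ S) :
    Pos E (flip ρ S hS) x ↔ Pos E ρ x := by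
  unfold Pos
  rw [flip_out hS h]

theorem pivot_tri {ρ : Perm G'.D} (hp : G'.IsPlanarStarEmbedding ρ) {x y z : G.D}
    (dx : G.degree x = 6) (dy : G.degree y = 6) (dz : G.degree z = 6)
    (lx : E.leader x) (ly : E.leader y) (lz : E.leader z)
    (hxy : x ≠ y) (hxz : x ≠ z)
    (exy : G'.edgeInv (E.R x) = E.L y) (eyz : G'.edgeInv (E.R y) = E.L z)
    (ezx : G'.edgeInv (E.R z) = E.L x)
    (sy : Pos E ρ y ↔ ¬ Pos E ρ x) (sz : Pos E ρ z ↔ ¬ Pos E ρ x) :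
    ∃ (S : Set G'.D) (h : ∀ d, ρ d ∈ S ↔ d ∈ S), E.L x ∈ S ∧ E.L y ∉ S ∧ E.L z ∉ S ∧
      (∀ d ∈ S, d ≠ E.L x → d ≠ E.R x → G'.edgeInv d ∈ S) ∧
      cc (flip ρ S h * G'.edgeInv) = cc (ρ * G'.edgeInv) := by
  have hpl := planar_ineq hp
  have hinv := G'.edgeInv_invol
  have exy' : G'.edgeInv (E.L y) = E.R x := by rw [← exy, hinv]
  have eyz' : G'.edgeInv (E.L z) = E.R y := by rw [← eyz, hinv]
  have ezx' : G'.edgeInv (E.L x) = E.R z := by rw [← ezx, hinv]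
  have fx := frame E hp.1 dx lx
  have fy := frame E hp.1 dy ly
  have fz := frame E hp.1 dz lz
  have nx := fun d => E.new_not_old x d dx lx
  have Lyx : E.L y ≠ E.L x := fun h => hxy (L_inj E dy ly dx lx h).symm
  have Lzx : E.L z ≠ E.L x := fun h => hxz (L_inj E dz lz dx lx h).symm
  have Ryx : E.R y ≠ E.R x := fun h => hxy (R_inj E dy ly dx lx h).symm
  have Rzx : E.R z ≠ E.R x := fun h => hxz (R_inj E dz lz dx lx h).symm
  by_cases hpx : Pos E ρ x
  · obtain ⟨-, x1, x2, x3, x4⟩ := fx.resolve_right (fun h => h.1 hpx)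
    obtain ⟨-, y1, y2, y3, y4⟩ := fy.resolve_left (fun h => sy.1 h.1 hpx)
    obtain ⟨-, z1, z2, z3, z4⟩ := fz.resolve_left (fun h => sz.1 h.1 hpx)
    obtain ⟨S, hS, m1, m2, m3, m4, m5⟩ := pivot ρ G'.edgeInv hinv hpl x1 x2 x3 x4 exy y4 eyz z4 ezx
      (nx _).1 (L_ne_R E dx lx dx lx).symm (nx _).2 (nx _).1.symm
      Lyx (L_ne_R E dy ly dx lx) Lzx (L_ne_R E dz lz dx lx)
    exact ⟨S, hS, m1, m2, m3, m4, m5⟩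
  · obtain ⟨-, x1, x2, x3, x4⟩ := fx.resolve_left (fun h => hpx h.1)
    obtain ⟨-, y1, y2, y3, y4⟩ := fy.resolve_right (fun h => h.1 (sy.2 hpx))
    obtain ⟨-, z1, z2, z3, z4⟩ := fz.resolve_right (fun h => h.1 (sz.2 hpx))
    obtain ⟨S, hS, m1, m2, m3, m4, m5⟩ := pivot ρ G'.edgeInv hinv hpl x1 x2 x3 x4
      ezx' z4 eyz' y4 exy'
      (nx _).2 (L_ne_R E dx lx dx lx) (nx _).1 (nx _).2.symm
      Rzx (L_ne_R E dx lx dz lz).symm Ryx (L_ne_R E dx lx dy ly).symm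
    refine ⟨S, hS, (mem_LR E hp.1 dx lx hS).1 m1, mt (mem_LR E hp.1 dy ly hS).2 m3,
      mt (mem_LR E hp.1 dz lz hS).2 m2, fun d h h1 h2 => m4 d h h2 h1, m5⟩

/-- all new vertices of the triangle at `x` have the same orientation -/
def Good (ρ : Perm G'.D) (x : G.D) : Prop :=
  ∀ y, G.SameVertex x y → E.leader y → (Pos E ρ y ↔ Pos E ρ x)

theorem step {ρ : Perm G'.D} (hp : G'.IsPlanarStarEmbedding ρ) {w : G.D}
    (dw : G.degree w = 6) (lw : E.leader w)
    (s2 : Pos E ρ ((G.rot ^ 2) w) ↔ ¬ Pos E ρ w)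
    (s4 : Pos E ρ ((G.rot ^ 4) w) ↔ ¬ Pos E ρ w) :
    ∃ ρ', G'.IsPlanarStarEmbedding ρ' ∧ Good E ρ' w ∧
      ∀ x, G.degree x = 6 → E.leader x → Good E ρ x → Good E ρ' x := by
  have d2 : G.degree ((G.rot ^ 2) w) = 6 := by rw [deg_same (sv_pow w 2), dw]
  have d4 : G.degree ((G.rot ^ 4) w) = 6 := by rw [deg_same (sv_pow w 4), dw]
  have l2 := (leader_two E dw).2 lw
  have l4 := (leader_four E dw).2 lw
  obtain ⟨S, hS, m1, m2, m3, m4, m5⟩ : ∃ (S : Set G'.D) (h : ∀ d, ρ d ∈ S ↔ d ∈ S),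
      E.L w ∈ S ∧ E.L ((G.rot ^ 2) w) ∉ S ∧ E.L ((G.rot ^ 4) w) ∉ S ∧
      (∀ d ∈ S, d ≠ E.L w → d ≠ E.R w → G'.edgeInv d ∈ S) ∧
      cc (flip ρ S h * G'.edgeInv) = cc (ρ * G'.edgeInv) := by
    rcases E.triangle w dw with h | h
    · have t0 := h w (sv_pow w 0) lw
      have t2 := h _ (sv_pow w 2) l2
      have t4 := h _ (sv_pow w 4) l4
      rw [rot24] at t2
      rw [rot26 dw] at t4
      exact pivot_tri E hp dw d2 d4 lw l2 l4 (rot2_ne dw).symm (rot4_ne dw).symm t0 t2 t4 s2 s4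
    · have t0 := h w (sv_pow w 0) lw
      have t2 := h _ (sv_pow w 2) l2
      have t4 := h _ (sv_pow w 4) l4
      rw [rot46 dw] at t2
      rw [rot48 dw] at t4
      obtain ⟨S, hS, m1, m2, m3, m4⟩ := pivot_tri E hp dw d4 d2 lw l4 l2 (rot4_ne dw).symm
        (rot2_ne dw).symm t0 t4 t2 s4 s2
      exact ⟨S, hS, m1, m3, m2, m4⟩
  have pw := pos_flip_in E hp.1 dw lw hS m1
  have hgw : Good E (flip ρ S hS) w := by
    intro y hy ly
    rcases leaders E dw lw hy ly with rfl | rfl | rfl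
    · rfl
    · rw [pos_flip_out E hS m2, pw, s2]
    · rw [pos_flip_out E hS m3, pw, s4]
  refine ⟨flip ρ S hS, planar_flip hp S hS m5, hgw, ?_⟩
  intro x dx lx hg
  by_cases hwx : G.SameVertex w x
  · intro y hy ly
    rw [hgw y (hwx.trans hy) ly, hgw x hwx lx]
  have move : ∀ u v, G.SameVertex x u → G.SameVertex x v → E.leader u → E.leader v →
      E.L u ∈ S → E.L v ∈ S := by
    intro u v hu hv lu lv hm
    have du : G.degree u = 6 := by rw [deg_same hu, dx]
    have nxt : ∀ t, G.SameVertex x t → E.leader t → E.L t ∈ S → G'.edgeInv (E.R t) ∈ S := by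
      intro t ht lt htS
      have dt : G.degree t = 6 := by rw [deg_same ht, dx]
      apply m4 _ ((mem_LR E hp.1 dt lt hS).2 htS)
      · exact (L_ne_R E dw lw dt lt).symm
      · intro he
        apply hwx
        rw [R_inj E dt lt dw lw he] at ht
        exact ht.symm
    have u2 : G.SameVertex x ((G.rot ^ 2) u) := hu.trans (sv_pow u 2)
    have u4 : G.SameVertex x ((G.rot ^ 4) u) := hu.trans (sv_pow u 4)
    have lu2 := (leader_two E du).2 lu
    have lu4 := (leader_four E du).2 lu
    have both : E.L ((G.rot ^ 2) u) ∈ S ∧ E.L ((G.rot ^ 4) u) ∈ S := by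
      rcases E.triangle x dx with h | h
      · have a1 := nxt u hu lu hm
        rw [h u hu lu] at a1
        have a2 := nxt _ u2 lu2 a1
        rw [h _ u2 lu2, rot24] at a2
        exact ⟨a1, a2⟩
      · have a1 := nxt u hu lu hm
        rw [h u hu lu] at a1
        have a2 := nxt _ u4 lu4 a1
        rw [h _ u4 lu4, rot48 du] at a2
        exact ⟨a2, a1⟩
    rcases leaders E du lu (hu.symm.trans hv) lv with rfl | rfl | rfl
    exacts [hm, both.1, both.2]
  intro y hy ly
  have dy : G.degree y = 6 := by rw [deg_same hy, dx]
  have hxx : G.SameVertex x x := sv_pow x 0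
  by_cases hm : E.L x ∈ S
  · rw [pos_flip_in E hp.1 dx lx hS hm,
      pos_flip_in E hp.1 dy ly hS (move x y hxx hy lx ly hm), hg y hy ly]
  · rw [pos_flip_out E hS hm, pos_flip_out E hS (fun h => hm (move y x hy hxx ly lx h)),
      hg y hy ly]

theorem step_bad {ρ : Perm G'.D} (hp : G'.IsPlanarStarEmbedding ρ) {x : G.D}
    (dx : G.degree x = 6) (lx : E.leader x) (hb : ¬ Good E ρ x) :
    ∃ ρ', G'.IsPlanarStarEmbedding ρ' ∧ Good E ρ' x ∧
      ∀ y, G.degree y = 6 → E.leader y → Good E ρ y → Good E ρ' y := by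
  have d2 : G.degree ((G.rot ^ 2) x) = 6 := by rw [deg_same (sv_pow x 2), dx]
  have d4 : G.degree ((G.rot ^ 4) x) = 6 := by rw [deg_same (sv_pow x 4), dx]
  have l2 := (leader_two E dx).2 lx
  have l4 := (leader_four E dx).2 lx
  obtain ⟨w, hw, lw, s2, s4⟩ : ∃ w, G.SameVertex x w ∧ E.leader w ∧
      (Pos E ρ ((G.rot ^ 2) w) ↔ ¬ Pos E ρ w) ∧ (Pos E ρ ((G.rot ^ 4) w) ↔ ¬ Pos E ρ w) := by
    by_cases h2 : Pos E ρ ((G.rot ^ 2) x) ↔ Pos E ρ x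
    · by_cases h4 : Pos E ρ ((G.rot ^ 4) x) ↔ Pos E ρ x
      · exfalso
        apply hb
        intro y hy ly
        rcases leaders E dx lx hy ly with rfl | rfl | rfl
        exacts [Iff.rfl, h2, h4]
      · refine ⟨(G.rot ^ 4) x, sv_pow x 4, l4, ?_, ?_⟩
        · rw [rot26 dx]; tauto
        · rw [rot48 dx]; tauto
    · by_cases h4 : Pos E ρ ((G.rot ^ 4) x) ↔ Pos E ρ x
      · refine ⟨(G.rot ^ 2) x, sv_pow x 2, l2, ?_, ?_⟩
        · rw [rot24]; tauto
        · rw [rot46 dx]; tauto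
      · exact ⟨x, sv_pow x 0, lx, by tauto, by tauto⟩
  obtain ⟨ρ', h1, h2, h3⟩ := step E hp (by rw [deg_same hw, dx]) lw s2 s4
  refine ⟨ρ', h1, ?_, h3⟩
  intro y hy ly
  rw [h2 y (hw.symm.trans hy) ly, h2 x hw.symm lx]

theorem all_good (n : ℕ) : ∀ ρ : Perm G'.D, G'.IsPlanarStarEmbedding ρ →
    {x : G.D | G.degree x = 6 ∧ E.leader x ∧ ¬ Good E ρ x}.ncard ≤ n →
    ∃ ρ', G'.IsPlanarStarEmbedding ρ' ∧ ∀ x, G.degree x = 6 → E.leader x → Good E ρ' x := by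
  induction n with
  | zero =>
    intro ρ hp hn
    refine ⟨ρ, hp, ?_⟩
    intro x dx lx
    by_contra hb
    rw [Nat.le_zero, Set.ncard_eq_zero (Set.toFinite _)] at hn
    exact (Set.ext_iff.1 hn x).1 ⟨dx, lx, hb⟩
  | succ n ih =>
    intro ρ hp hn
    by_cases hall : ∀ x, G.degree x = 6 → E.leader x → Good E ρ x
    · exact ⟨ρ, hp, hall⟩
    push Not at hall
    obtain ⟨x, dx, lx, hb⟩ := hall
    obtain ⟨ρ', h1, h2, h3⟩ := step_bad E hp dx lx hb
    apply ih ρ' h1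
    have : {x : G.D | G.degree x = 6 ∧ E.leader x ∧ ¬ Good E ρ' x}.ncard <
        {x : G.D | G.degree x = 6 ∧ E.leader x ∧ ¬ Good E ρ x}.ncard := by
      apply Set.ncard_lt_ncard _ (Set.toFinite _)
      refine ⟨fun y hy => ⟨hy.1, hy.2.1, fun hg => hy.2.2 (h3 y hy.1 hy.2.1 hg)⟩, ?_⟩
      intro hsub
      exact (hsub (show x ∈ _ from ⟨dx, lx, hb⟩)).2.2 h2
    omega

theorem good_bounds {ρ : Perm G'.D} (hc : G'.IsCompatibleRotation ρ) {x : G.D}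
    (dx : G.degree x = 6) (lx : E.leader x) (hg : Good E ρ x) :
    BoundsEmptyRegion G' ρ (E.TriangleDarts x) := by
  have hxx : G.SameVertex x x := sv_pow x 0
  have hinv := G'.edgeInv_invol
  have dd : ∀ y, G.SameVertex x y → G.degree y = 6 := fun y hy => by rw [deg_same hy, dx]
  -- next and previous leaders
  have hnext : ∀ y, G.SameVertex x y → E.leader y → ∃ z, G.SameVertex x z ∧ E.leader z ∧
      G'.edgeInv (E.R y) = E.L z := by
    intro y hy ly
    rcases E.triangle x dx with h | h
    · exact ⟨_, hy.trans (sv_pow y 2), (leader_two E (dd y hy)).2 ly, h y hy ly⟩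
    · exact ⟨_, hy.trans (sv_pow y 4), (leader_four E (dd y hy)).2 ly, h y hy ly⟩
  have hprev : ∀ y, G.SameVertex x y → E.leader y → ∃ z, G.SameVertex x z ∧ E.leader z ∧
      G'.edgeInv (E.L y) = E.R z := by
    intro y hy ly
    have y2 : G.SameVertex x ((G.rot ^ 2) y) := hy.trans (sv_pow y 2)
    have y4 : G.SameVertex x ((G.rot ^ 4) y) := hy.trans (sv_pow y 4)
    have ly2 := (leader_two E (dd y hy)).2 ly
    have ly4 := (leader_four E (dd y hy)).2 ly
    rcases E.triangle x dx with h | h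
    · refine ⟨_, y4, ly4, ?_⟩
      have := h _ y4 ly4
      rw [rot26 (dd y hy)] at this
      rw [← this, hinv]
    · refine ⟨_, y2, ly2, ?_⟩
      have := h _ y2 ly2
      rw [rot46 (dd y hy)] at this
      rw [← this, hinv]
  have closed : ∀ (P : G'.D → Prop), (∀ d, P d → P (G'.facePerm ρ d)) → ∀ d e, P d →
      (G'.facePerm ρ).SameCycle d e → P e := by
    intro P hP d e hd hs
    obtain ⟨n, rfl⟩ := hs.exists_nat_pow_eq
    clear hs
    induction n with
    | zero => exact hd
    | succ n ih => rw [pow_succ', Perm.mul_apply]; exact hP _ ih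
  by_cases hpx : Pos E ρ x
  · refine ⟨E.L x, ⟨x, hxx, lx, Or.inl rfl⟩, ?_⟩
    have hcl := closed (fun d => ∃ y, G.SameVertex x y ∧ E.leader y ∧ d = E.L y) (by
      rintro d ⟨y, hy, ly, rfl⟩
      obtain ⟨z, hz, lz, he⟩ := hprev y hy ly
      refine ⟨z, hz, lz, ?_⟩
      unfold StarGraph.facePerm
      rw [Perm.mul_apply, he]
      exact ((frame E hc (dd z hz) lz).resolve_right (fun h => h.1 ((hg z hz lz).2 hpx))).2.2.2.2)
      (E.L x)
    intro e he
    obtain ⟨y, hy, ly, rfl⟩ := hcl e ⟨x, hxx, lx, rfl⟩ he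
    refine ⟨⟨y, hy, ly, Or.inl rfl⟩, ?_⟩
    intro hs
    obtain ⟨z, hz, lz, hze⟩ := hcl _ ⟨x, hxx, lx, rfl⟩ hs
    obtain ⟨t, ht, lt, hte⟩ := hprev y hy ly
    rw [hte] at hze
    exact L_ne_R E (dd z hz) lz (dd t ht) lt hze.symm
  · refine ⟨E.R x, ⟨x, hxx, lx, Or.inr rfl⟩, ?_⟩
    have hcl := closed (fun d => ∃ y, G.SameVertex x y ∧ E.leader y ∧ d = E.R y) (by
      rintro d ⟨y, hy, ly, rfl⟩
      obtain ⟨z, hz, lz, he⟩ := hnext y hy ly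
      refine ⟨z, hz, lz, ?_⟩
      unfold StarGraph.facePerm
      rw [Perm.mul_apply, he]
      exact ((frame E hc (dd z hz) lz).resolve_left (fun h => hpx ((hg z hz lz).1 h.1))).2.2.2.2)
      (E.R x)
    intro e he
    obtain ⟨y, hy, ly, rfl⟩ := hcl e ⟨x, hxx, lx, rfl⟩ he
    refine ⟨⟨y, hy, ly, Or.inr rfl⟩, ?_⟩
    intro hs
    obtain ⟨z, hz, lz, hze⟩ := hcl _ ⟨x, hxx, lx, rfl⟩ hs
    obtain ⟨t, ht, lt, hte⟩ := hnext y hy ly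
    rw [hte] at hze
    exact L_ne_R E (dd t ht) lt (dd z hz) lz hze

end expansion
end XP

/-- Let `G` be a *-graph all of whose vertices have degree 4 or 6 and let `G'`
be an expansion of `G`.  If `G'` admits an X-embedding into the sphere, then it
admits an X-embedding into the sphere in which every expansion triangle bounds
an empty region. -/
theorem exists_embedding_triangles_empty (G G' : StarGraph)
    (hdeg : ∀ d : G.D, G.degree d = 4 ∨ G.degree d = 6)
    (E : ExpansionData G G')
    (h : ∃ ρ : Equiv.Perm G'.D, G'.IsPlanarStarEmbedding ρ) :
    ∃ ρ : Equiv.Perm G'.D, G'.IsPlanarStarEmbedding ρ ∧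
      ∀ x : G.D, G.degree x = 6 → E.leader x →
        BoundsEmptyRegion G' ρ (E.TriangleDarts x) := by
  obtain ⟨ρ, hρ⟩ := h
  obtain ⟨ρ', h1, h2⟩ := XP.all_good E _ ρ hρ le_rfl
  exact ⟨ρ', h1, fun x dx lx => XP.good_bounds E h1.1 dx lx (h2 x dx lx)⟩
end
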